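/- Let (G,o) be a sourced Eulerian digraph and suppose μ is a proper Gibbs measure on Eulerian paths from o to ∞ in G. If X is a random path with law μ, then the last-exit arboretum 𝓛(X) is distributed as the wired uniform spanning in-arboretum WUA_G of G. -/

import Mathlib

open MeasureTheory Filter Set
open scoped ENNReal

namespace DF

/-! ### Sequences over a countable state space -/

variable {S : Type}

/-- The number of transitions from `u` to `v` among the first `n` steps of the sequence `x`. -/
noncomputable def transCount (x : ℕ → S) (n : ℕ) (u v : S) : ℕ :=
  Set.ncard {i : ℕ | i < n ∧ x i = u ∧ x (i + 1) = v}

/-- The equivalence `(x₀,…,xₙ) ≃ (y₀,…,yₙ)` of finite sequences: same initial state and the same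
transition counts between every ordered pair of states. -/
def FinEquiv (x y : ℕ → S) (n : ℕ) : Prop :=
  x 0 = y 0 ∧ ∀ u v : S, transCount x n u v = transCount y n u v

/-- The equivalence `x ≃ y` of infinite sequences: they eventually agree and their initial
segments up to that point are `≃`-equivalent. -/
def InfEquiv (x y : ℕ → S) : Prop :=
  ∃ N : ℕ, (∀ n : ℕ, N ≤ n → x n = y n) ∧ FinEquiv x y N

/-- The transition numbers `M(u,v) = #{i ≥ 0 : (xᵢ, xᵢ₊₁) = (u,v)}` of an infinite sequence. -/
noncomputable def transNum (x : ℕ → S) (u v : S) : ℕ∞ :=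
  Set.encard {i : ℕ | x i = u ∧ x (i + 1) = v}

/-- The sigma-algebra on `S^ℕ` generated by the transition numbers. -/
noncomputable def transSigma (S : Type) : MeasurableSpace (ℕ → S) :=
  ⨆ u : S, ⨆ v : S, MeasurableSpace.comap (fun x => transNum x u v) (⊤ : MeasurableSpace ℕ∞)

/-- The tail sigma-algebra `⋂ₙ σ(Xₙ, Xₙ₊₁, …)` on `S^ℕ`. -/
def tailSigma (S : Type) [MeasurableSpace S] : MeasurableSpace (ℕ → S) :=
  ⨅ n : ℕ, MeasurableSpace.comap (fun (x : ℕ → S) (i : ℕ) => x (i + n))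
    (inferInstance : MeasurableSpace (ℕ → S))

/-- A measure on `S^ℕ` is partially exchangeable if any two `≃`-equivalent finite initial
segments have the same probability. -/
def PartiallyExchangeable [MeasurableSpace S] (μ : Measure (ℕ → S)) : Prop :=
  ∀ (n : ℕ) (x y : ℕ → S), FinEquiv x y n →
    μ {ω | ∀ i ≤ n, ω i = x i} = μ {ω | ∀ i ≤ n, ω i = y i}

/-- The set of partially exchangeable probability measures on `S^ℕ`. -/
def PEProb (S : Type) [MeasurableSpace S] : Set (Measure (ℕ → S)) :=
  {μ | μ Set.univ = 1 ∧ PartiallyExchangeable μ}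

/-- `μ` is an extreme point of the convex set of partially exchangeable probability measures. -/
def IsExtremePE [MeasurableSpace S] (μ : Measure (ℕ → S)) : Prop :=
  μ ∈ PEProb S ∧
    ∀ μ₁ ∈ PEProb S, ∀ μ₂ ∈ PEProb S, ∀ t : ℝ≥0∞, 0 < t → t < 1 →
      μ = t • μ₁ + (1 - t) • μ₂ → μ₁ = μ₂

/-! ### Digraphs -/

/-- A digraph on vertex set `V` with edge set `E`: each edge has a tail (`src`) and head (`dst`).
Multiple edges and loops are allowed. -/
structure DigraphStruct (V E : Type) where
  src : E → V
  dst : E → V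

namespace DigraphStruct

variable {V E : Type} (G : DigraphStruct V E)

def outEdges (v : V) : Set E := {e | G.src e = v}

def inEdges (v : V) : Set E := {e | G.dst e = v}

noncomputable def outDeg (v : V) : ℕ := (G.outEdges v).ncard

noncomputable def inDeg (v : V) : ℕ := (G.inEdges v).ncard

def LocallyFinite : Prop := ∀ v : V, (G.outEdges v).Finite ∧ (G.inEdges v).Finite

/-- Adjacency in the underlying undirected graph. -/
def undirAdj (u v : V) : Prop :=
  ∃ e : E, (G.src e = u ∧ G.dst e = v) ∨ (G.src e = v ∧ G.dst e = u)

/-- `G` is connected as an undirected graph. -/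
def Connected : Prop := ∀ u v : V, Relation.ReflTransGen G.undirAdj u v

def dirAdj (u v : V) : Prop := ∃ e : E, G.src e = u ∧ G.dst e = v

/-- One step along an edge of the edge set `B`. -/
def step (B : Set E) (u v : V) : Prop := ∃ e ∈ B, G.src e = u ∧ G.dst e = v

/-- `(G,o)` is an infinite sourced Eulerian digraph (with sink at infinity). -/
structure IsSourcedEulerian (o : V) : Prop where
  infinite : Infinite V
  locFin : G.LocallyFinite
  conn : G.Connected
  balanced : ∀ v : V, v ≠ o → G.inDeg v = G.outDeg v
  source : G.outDeg o = G.inDeg o + 1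

/-- The reversal of `G`: head and tail of every edge are exchanged. -/
def rev : DigraphStruct V E := ⟨G.dst, G.src⟩

/-- One-step transition probability of the random walk on `G`. -/
noncomputable def stepProb (u v : V) : ℝ≥0∞ :=
  ({e : E | G.src e = u ∧ G.dst e = v}.ncard : ℝ≥0∞) / (G.outDeg u : ℝ≥0∞)

open Classical in
/-- `μ` is the law of the random walk on `G` started at `o`, characterised through its cylinder
probabilities. -/
def IsWalkLaw [MeasurableSpace V] (o : V) (μ : Measure (ℕ → V)) : Prop :=
  μ Set.univ = 1 ∧
    ∀ (n : ℕ) (x : ℕ → V),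
      μ {ω | ∀ i ≤ n, ω i = x i} =
        if x 0 = o then ∏ i ∈ Finset.range n, G.stepProb (x i) (x (i + 1)) else 0

/-- `G` is transient: from every starting point, the random walk on `G` visits every vertex at
most finitely often almost surely. -/
def TransientDigraph [MeasurableSpace V] : Prop :=
  ∀ (o : V) (μ : Measure (ℕ → V)),
    G.IsWalkLaw o μ → μ {ω | ∀ v : V, {i : ℕ | ω i = v}.Finite} = 1

/-- An infinite path in `G` indexed by `ℕ`, encoded by its sequence of edges. -/
def IsInfPath (γ : ℕ → E) : Prop := ∀ i : ℕ, G.dst (γ i) = G.src (γ (i + 1))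

/-- A transient path: it visits every vertex at most finitely often. -/
def IsTransientPath (γ : ℕ → E) : Prop := ∀ v : V, {i : ℕ | G.src (γ i) = v}.Finite

/-- The edge set of the last-exit arboretum `𝓛(γ)`: the edges crossed by `γ` as it exits their
tail for the last time. -/
def lastExitSet (γ : ℕ → E) : Set E :=
  {e | ∃ i : ℕ, γ i = e ∧ ∀ j : ℕ, i < j → G.src (γ j) ≠ G.src (γ i)}

end DigraphStruct

/-! ### Finite paths, Eulerian paths, arborescences -/

/-- `IsPathList G o z P` means that the list of edges `P` forms a directed path from `o`
to `z` in `G`. -/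
def IsPathList {V E : Type} (G : DigraphStruct V E) : V → V → List E → Prop
  | o, z, [] => o = z
  | o, z, e :: es => G.src e = o ∧ IsPathList G (G.dst e) z es

/-- `P` is an Eulerian path from `o` to `z`: a path crossing every edge exactly once. -/
def IsEulerList {V E : Type} (G : DigraphStruct V E) (o z : V) (P : List E) : Prop :=
  IsPathList G o z P ∧ P.Nodup ∧ ∀ e : E, e ∈ P

/-- `B` is (the edge set of) a spanning in-arborescence of `G` rooted at `z`. -/
def IsFinArb {V E : Type} (G : DigraphStruct V E) (z : V) (B : Set E) : Prop :=
  (∀ e ∈ B, G.src e ≠ z) ∧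
  (∀ v : V, v ≠ z → ∃! e : E, e ∈ B ∧ G.src e = v) ∧
  (∀ v : V, Relation.ReflTransGen (G.step B) v z)

/-- `(G,o,z)` is a finite Eulerian digraph with source `o` and sink `z`. -/
structure IsFinEulerian {V E : Type} (G : DigraphStruct V E) (o z : V) : Prop where
  finV : Finite V
  finE : Finite E
  reach_from : ∀ v : V, Relation.ReflTransGen G.dirAdj o v
  reach_to : ∀ v : V, Relation.ReflTransGen G.dirAdj v z
  bal_ne : o ≠ z → (∀ v : V, v ≠ o → v ≠ z → G.inDeg v = G.outDeg v) ∧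
      G.outDeg o = G.inDeg o + 1 ∧ G.inDeg z = G.outDeg z + 1
  bal_eq : o = z → ∀ v : V, G.inDeg v = G.outDeg v

/-! ### Wired uniform spanning in-arborescences -/

/-- An exhaustion of the vertex set by finite subsets. -/
def IsExhaustion {V : Type} (Vn : ℕ → Set V) : Prop :=
  (∀ n, (Vn n).Finite) ∧ (∀ n, Vn n ⊆ Vn (n + 1)) ∧ (⋃ n, Vn n) = Set.univ

/-- `B` is (the edge set of) a spanning in-arborescence of the wired graph `G_U^*`
(all vertices outside `U` identified to a single boundary vertex) rooted at the boundary. -/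
def IsWiredArb {V E : Type} (G : DigraphStruct V E) (U : Set V) (B : Set E) : Prop :=
  (∀ e ∈ B, G.src e ∈ U) ∧ (∀ v ∈ U, ∃! e : E, e ∈ B ∧ G.src e = v) ∧
  (∀ v ∈ U, ∃ v' : V, v' ∉ U ∧ Relation.ReflTransGen (G.step B) v v')

/-- The probability, under the uniform spanning in-arborescence of the wired graph `G_U^*`
rooted at the boundary, that all edges of `F` are present. -/
noncomputable def wiredUACyl {V E : Type} (G : DigraphStruct V E) (U : Set V) (F : Finset E) :
    ℝ≥0∞ :=
  (Nat.card {B : Set E // IsWiredArb G U B ∧ (F : Set E) ⊆ B} : ℝ≥0∞) /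
    (Nat.card {B : Set E // IsWiredArb G U B} : ℝ≥0∞)

/-- `κ` is the law of the wired uniform spanning in-arboretum of `G` (as a random edge set,
encoded as an element of `E → Bool`): its cylinder probabilities are the limits along any
exhaustion of the uniform spanning in-arborescence measures of the wired graphs. -/
def IsWUALaw {V E : Type} (G : DigraphStruct V E) (κ : Measure (E → Bool)) : Prop :=
  κ Set.univ = 1 ∧
    ∀ Vn : ℕ → Set V, IsExhaustion Vn → ∀ F : Finset E,
      Filter.Tendsto (fun n => wiredUACyl G (Vn n) F) Filter.atTop
        (nhds (κ {A | ∀ e ∈ F, A e = true}))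

/-- A spanning in-arboretum rooted at infinity all of whose components are one-ended:
every vertex has out-degree exactly one, and the past of every vertex is finite. -/
def IsOneEndedSpanningArb {V E : Type} (G : DigraphStruct V E) (A : Set E) : Prop :=
  (∀ v : V, ∃! e : E, e ∈ A ∧ G.src e = v) ∧
    ∀ v : V, {u : V | Relation.ReflTransGen (G.step A) u v}.Finite

/-! ### Proper Gibbs measures on Eulerian paths -/

/-- `w` is a finite path in `G` starting at `o` (encoded by its edges). -/
def PrefixPath {V E : Type} (G : DigraphStruct V E) (o : V) {n : ℕ} (w : Fin n → E) : Prop :=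
  (∀ h : 0 < n, G.src (w ⟨0, h⟩) = o) ∧
    ∀ (i : ℕ) (h : i + 1 < n), G.dst (w ⟨i, Nat.lt_of_succ_lt h⟩) = G.src (w ⟨i + 1, h⟩)

/-- A proper Gibbs measure on Eulerian paths from `o` to `∞` in `G`: a probability measure on
edge sequences, supported on half-infinite paths started at `o` crossing every edge exactly once,
such that conditionally on the steps after time `n` the first `n` steps are a uniform Eulerian
path (from `o`, in the digraph spanned by the edges not crossed after time `n`, to the position
at time `n`). Uniformity is expressed by invariance under replacing the first `n` steps by any
other path from `o` crossing the same set of edges. -/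
def ProperGibbs {V E : Type} [MeasurableSpace E] (G : DigraphStruct V E) (o : V)
    (μ : Measure (ℕ → E)) : Prop :=
  μ Set.univ = 1 ∧
  μ {γ | (∀ i : ℕ, G.dst (γ i) = G.src (γ (i + 1))) ∧ G.src (γ 0) = o ∧ Function.Bijective γ}
      = 1 ∧
  ∀ (n : ℕ) (w w' : Fin n → E), Function.Injective w → Function.Injective w' →
    Set.range w = Set.range w' → PrefixPath G o w → PrefixPath G o w' →
    ∀ B : Set (ℕ → E),
      μ {γ | (∀ i : Fin n, γ (i : ℕ) = w i) ∧ (fun t : ℕ => γ (n + t)) ∈ B} =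
        μ {γ | (∀ i : Fin n, γ (i : ℕ) = w' i) ∧ (fun t : ℕ => γ (n + t)) ∈ B}

/-! ### Loop erasure and Wilson's algorithm rooted at infinity -/

/-- The loop-erasure times of the (transient) vertex sequence `p`:
`t₀ = 0`, `tᵢ₊₁ = 1 + max {t ≥ tᵢ : p t = p tᵢ}`. -/
noncomputable def leTimes {V : Type} (p : ℕ → V) : ℕ → ℕ
  | 0 => 0
  | i + 1 => sSup {t : ℕ | leTimes p i ≤ t ∧ p t = p (leTimes p i)} + 1

/-- The loop-erasure times of the vertex sequence `p` run up to time `k`. -/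
noncomputable def leTimesF {V : Type} (p : ℕ → V) (k : ℕ) : ℕ → ℕ
  | 0 => 0
  | i + 1 => sSup {t : ℕ | leTimesF p k i ≤ t ∧ t ≤ k ∧ p t = p (leTimesF p k i)} + 1

/-- The set of vertices incident to an edge of `A`. -/
def vertsOf {V E : Type} (G : DigraphStruct V E) (A : Set E) : Set V :=
  {u | ∃ e ∈ A, G.src e = u ∨ G.dst e = u}

open Classical in
/-- The set of edges of the loop-erasure of the walk `x` (an edge sequence) stopped when it
first hits `U`; if it never hits `U`, the loop-erasure of the whole (transient) walk. -/
noncomputable def stoppedLEedges {V E : Type} (G : DigraphStruct V E) (U : Set V) (x : ℕ → E) :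
    Set E :=
  if ∃ t : ℕ, G.src (x t) ∈ U then
    {e | ∃ i : ℕ,
      leTimesF (fun t => G.src (x t)) (sInf {t : ℕ | G.src (x t) ∈ U}) i <
          sInf {t : ℕ | G.src (x t) ∈ U} ∧
        x (leTimesF (fun t => G.src (x t)) (sInf {t : ℕ | G.src (x t) ∈ U}) i) = e}
  else Set.range fun i => x (leTimes (fun t => G.src (x t)) i)

/-- The partial edge sets generated by Wilson's algorithm rooted at infinity, run with the
enumeration `v` of the vertices and with `W j` the random walk used at stage `j + 1`
(started at `v j`). -/
noncomputable def wilsonA {V E : Type} (G : DigraphStruct V E) (v : ℕ → V) (W : ℕ → ℕ → E) :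
    ℕ → Set E
  | 0 => ∅
  | j + 1 =>
      wilsonA G v W j ∪
        stoppedLEedges G (vertsOf G (wilsonA G v W j) ∪ {u | ∃ i < j, v i = u}) (W j)

open Classical in
/-- Cylinder probabilities for the random walk on `G` started at `v`, recorded as a sequence of
edges: the probability that the first `n` crossed edges are `x 0, …, x (n-1)`. -/
noncomputable def edgeWalkCyl {V E : Type} (G : DigraphStruct V E) (v : V) (x : ℕ → E) (n : ℕ) :
    ℝ≥0∞ :=
  if (0 < n → G.src (x 0) = v) ∧ (∀ i : ℕ, i + 1 < n → G.dst (x i) = G.src (x (i + 1))) then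
    ∏ i ∈ Finset.range n, ((G.outDeg (G.src (x i)) : ℝ≥0∞))⁻¹
  else 0

/-- `P` is the joint law of a sequence of independent random walks on `G`, the `j`-th walk
started at `v j`. -/
def IsIndepWalksLaw {V E : Type} [MeasurableSpace E] (G : DigraphStruct V E) (v : ℕ → V)
    (P : Measure (ℕ → ℕ → E)) : Prop :=
  P Set.univ = 1 ∧
    ∀ (m n : ℕ) (x : ℕ → ℕ → E),
      P {ω | ∀ j < m, ∀ t < n, ω j t = x j t} =
        ∏ j ∈ Finset.range m, edgeWalkCyl G (v j) (x j) n

/-- `μ` is the law of the random walk on `G` started at `o`, recorded as its sequence of crossed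
edges. -/
def IsEdgeWalkLaw {V E : Type} [MeasurableSpace E] (G : DigraphStruct V E) (o : V)
    (μ : Measure (ℕ → E)) : Prop :=
  μ Set.univ = 1 ∧ ∀ (n : ℕ) (x : ℕ → E), μ {ω | ∀ i < n, ω i = x i} = edgeWalkCyl G o x n

/-! ### Finite approximations and Gibbs measures on arboreta -/

/-- A finite digraph with vertices and edges labelled by natural numbers. -/
structure FinDigraph where
  VS : Finset ℕ
  ES : Finset ℕ
  fsrc : ℕ → ℕ
  fdst : ℕ → ℕ

/-- `B` is a spanning in-arborescence of the finite digraph `H` rooted at `z`. -/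
def FinDigraph.IsArb (H : FinDigraph) (z : ℕ) (B : Finset ℕ) : Prop :=
  B ⊆ H.ES ∧ (∀ e ∈ B, H.fsrc e ≠ z) ∧
  (∀ v ∈ H.VS, v ≠ z → ∃! e : ℕ, e ∈ B ∧ H.fsrc e = v) ∧
  (∀ v ∈ H.VS, Relation.ReflTransGen
      (fun a b => ∃ e ∈ B, H.fsrc e = a ∧ H.fdst e = b) v z)

/-- A finite digraph `H` with a distinguished vertex `z`, together with a partial isomorphism
to a digraph on `(V, E)`: vertex and edge domains `A`, `F` in `H` and maps `φV`, `φE` to `V`, `E`. -/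
structure PIso (V E : Type) where
  H : FinDigraph
  z : ℕ
  A : Finset ℕ
  F : Finset ℕ
  φV : ℕ → V
  φE : ℕ → E

/-- The data of `p` really is a partial isomorphism to `G`. -/
def PIso.Valid {V E : Type} (p : PIso V E) (G : DigraphStruct V E) : Prop :=
  ↑p.A ⊆ ↑p.H.VS ∧ ↑p.F ⊆ ↑p.H.ES ∧ p.z ∈ p.H.VS ∧
  Set.InjOn p.φV ↑p.A ∧ Set.InjOn p.φE ↑p.F ∧
  ∀ e ∈ p.F, p.H.fsrc e ∈ p.A ∧ p.H.fdst e ∈ p.A ∧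
    G.src (p.φE e) = p.φV (p.H.fsrc e) ∧ G.dst (p.φE e) = p.φV (p.H.fdst e)

/-- The partial isomorphism `p` identifies a neighbourhood of (a preimage of) `w`:
`w` is in the range of `φV` and `φE` maps the edges incident to its preimage bijectively onto
the edges incident to `w`. -/
def PIso.GoodAt {V E : Type} (p : PIso V E) (G : DigraphStruct V E) (w : V) : Prop :=
  ∃ w' ∈ p.A, p.φV w' = w ∧
    (∀ e' ∈ p.H.ES, (p.H.fsrc e' = w' ∨ p.H.fdst e' = w') → e' ∈ p.F) ∧
    ∀ e : E, (G.src e = w ∨ G.dst e = w) →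
      ∃! e' : ℕ, e' ∈ p.F ∧ (p.H.fsrc e' = w' ∨ p.H.fdst e' = w') ∧ p.φE e' = e

/-- `a` is a finite approximation to `G`: a sequence of finite digraphs with distinguished
vertices `zₙ` and partial isomorphisms to `G`, identifying larger and larger neighbourhoods of
every finite vertex set, with the distinguished vertices escaping to infinity. -/
def IsFinApproxSeq {V E : Type} (G : DigraphStruct V E) (a : ℕ → PIso V E) : Prop :=
  (∀ n, (a n).Valid G) ∧
  (∀ W : Finset V, ∃ N, ∀ n ≥ N, ∀ w ∈ W, (a n).GoodAt G w) ∧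
  (∀ W : Finset V, ∃ N, ∀ n ≥ N, ¬((a n).z ∈ (a n).A ∧ (a n).φV (a n).z ∈ (W : Set V)))

/-- The probability, under the uniform spanning in-arborescence of `p.H` rooted at `p.z`, that
every edge of `F` is in the image of the arborescence under the partial isomorphism. -/
noncomputable def pisoUACyl {V E : Type} (p : PIso V E) (F : Finset E) :
    ℝ≥0∞ :=
  (Nat.card {B : Finset ℕ // p.H.IsArb p.z B ∧ ∀ e ∈ F, ∃ e' ∈ B, e' ∈ p.F ∧ p.φE e' = e} :
      ℝ≥0∞) /
    (Nat.card {B : Finset ℕ // p.H.IsArb p.z B} : ℝ≥0∞)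

/-- `μ` (a measure on edge sets, encoded as elements of `E → Bool`) is a Gibbs measure on
spanning in-arboreta of `G` rooted at infinity: it is a weak limit of mixtures (over a random
finite approximation to `G`) of uniform spanning in-arborescence measures on finite
approximations to `G`. -/
def IsArbGibbs {V E : Type} (G : DigraphStruct V E) (μ : Measure (E → Bool)) : Prop :=
  μ Set.univ = 1 ∧
  ∃ (Ω : Type) (mΩ : MeasurableSpace Ω) (ν : @Measure Ω mΩ) (a : Ω → ℕ → PIso V E),
    ν Set.univ = 1 ∧ (∀ ω : Ω, IsFinApproxSeq G (a ω)) ∧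
    ∀ F : Finset E,
      Filter.Tendsto (fun n => ∫⁻ ω, pisoUACyl (a ω n) F ∂ν) Filter.atTop
        (nhds (μ {A : E → Bool | ∀ e ∈ F, A e = true}))

/-! ### Stacks -/

open Classical in
/-- The state (current vertex, remaining stacks) after `n` steps of following the stacks `σ`
starting from `o`: at each step we cross the edge at the front of the list at the current vertex
and delete it from the list (doing nothing if the list is empty). -/
noncomputable def stackState {V E : Type} (G : DigraphStruct V E) (o : V) (σ : V → List E) :
    ℕ → V × (V → List E)
  | 0 => (o, σ)
  | n + 1 =>
    let p := stackState G o σ n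
    match p.2 p.1 with
    | [] => p
    | e :: rest => (G.dst e, Function.update p.2 p.1 rest)

/-- The edge crossed at step `n` when following the stacks `σ` from `o` (`none` if the
current stack is exhausted). -/
noncomputable def stackEdge {V E : Type} (G : DigraphStruct V E) (o : V) (σ : V → List E)
    (n : ℕ) : Option E :=
  ((stackState G o σ n).2 (stackState G o σ n).1).head?

/-- The sigma-algebra on stack configurations. -/
noncomputable def stackMS (V E : Type) : MeasurableSpace (V → List E) :=
  @MeasurableSpace.pi V (fun _ => List E) fun _ => ⊤

open Classical in
/-- `ρ` is the law of the random stack configuration built from a random arboretum with law `κ`: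
place the arboretum edge at the bottom of the stack at each vertex, and an independent,
uniformly random ordering of the remaining outgoing edges on top of it. -/
def IsStackLaw {V E : Type} (G : DigraphStruct V E) (κ : Measure (E → Bool))
    (ρ : @Measure (V → List E) (stackMS V E)) : Prop :=
  ρ Set.univ = 1 ∧
    ∀ (K : Finset V) (s : V → List E),
      ρ {σ | ∀ v ∈ K, σ v = s v} =
        if ∀ v ∈ K, (s v).Nodup ∧ ∀ e : E, e ∈ s v ↔ G.src e = v then
          κ {A | ∀ v ∈ K, ∃ e : E, (s v).getLast? = some e ∧ A e = true} *
            ∏ v ∈ K, (((G.outDeg v - 1).factorial : ℝ≥0∞))⁻¹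
        else 0

/-! ### Markov chains -/

open Classical in
/-- `ν` is the law of the trajectory of a Markov chain with state space `S' ⊆ S`, transition
kernel `p` and deterministic initial state `s0`. -/
def IsMCLaw {S : Type} [MeasurableSpace S] (S' : Set S) (p : S → S → ℝ≥0∞) (s0 : S)
    (ν : Measure (ℕ → S)) : Prop :=
  ν Set.univ = 1 ∧ s0 ∈ S' ∧
  (∀ u ∈ S', (∑' v : S, p u v) = 1 ∧ ∀ v : S, p u v ≠ 0 → v ∈ S') ∧
  (∀ u : S, u ∉ S' → ∀ v : S, p u v = 0) ∧
  ∀ (n : ℕ) (y : ℕ → S),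
    ν {x | ∀ i ≤ n, x i = y i} =
      if y 0 = s0 then ∏ i ∈ Finset.range n, p (y i) (y (i + 1)) else 0

/-- `ν` is the law of the trajectory of a recurrent Markov chain on a subset of `S` with
non-random initial state: the chain returns to its initial state infinitely often a.s. -/
def IsRecMCLaw {S : Type} [MeasurableSpace S] (ν : Measure (ℕ → S)) : Prop :=
  ∃ (S' : Set S) (p : S → S → ℝ≥0∞) (s0 : S),
    IsMCLaw S' p s0 ν ∧ ν {x | {i : ℕ | x i = s0}.Infinite} = 1

/-- `ν` is the law of the sequence of vertices visited by (the unique) proper Gibbs measure on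
Eulerian paths from `o` to `∞` on a sourced Eulerian digraph whose vertex set is a subset
of `S`. -/
def IsGibbsVertexLaw {S : Type} [MeasurableSpace S] (ν : Measure (ℕ → S)) : Prop :=
  ∃ (Vs : Set S) (E : Type) (mE : MeasurableSpace E) (G : DigraphStruct (↥Vs) E) (o : ↥Vs),
    Countable E ∧ G.IsSourcedEulerian o ∧
    ∃ μp : @Measure (ℕ → E) (@MeasurableSpace.pi ℕ (fun _ => E) fun _ => mE),
      @ProperGibbs (↥Vs) E mE G o μp ∧
      ∀ A : Set (ℕ → S), MeasurableSet A →
        ν A = μp ((fun (γ : ℕ → E) (i : ℕ) => ((G.src (γ i) : S))) ⁻¹' A)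

/-- Concatenation of a finite list with an infinite sequence. -/
def concatSeq {S : Type} (l : List S) (y : ℕ → S) : ℕ → S :=
  fun i => if h : i < l.length then l.get ⟨i, h⟩ else y (i - l.length)

/-- `ν` is the law of a process following a uniform random Eulerian path on a finite Eulerian
digraph with source and sink whose vertex set is a subset of `S`, followed by the trajectory of
an (independent) recurrent Markov chain on a disjoint subset of `S` with non-random initial
state. -/
def IsMixedLaw {S : Type} [MeasurableSpace S] (ν : Measure (ℕ → S)) : Prop :=
  ∃ (Vf : Finset S) (Ef : Type) (_ : Finite Ef)
    (Gf : DigraphStruct {s : S // s ∈ Vf} Ef) (of zf : {s : S // s ∈ Vf})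
    (Vr : Set S) (p : S → S → ℝ≥0∞) (s1 : S) (νMC : Measure (ℕ → S)),
    IsFinEulerian Gf of zf ∧ Disjoint (↑Vf : Set S) Vr ∧
    IsMCLaw Vr p s1 νMC ∧ νMC {x | {i : ℕ | x i = s1}.Infinite} = 1 ∧
    ∀ A : Set (ℕ → S), MeasurableSet A →
      ν A =
        (∑' L : {L : List Ef // IsEulerList Gf of zf L},
            νMC ((fun y => concatSeq (((of : S)) ::
              (L : List Ef).map fun e => ((Gf.dst e : S))) y) ⁻¹' A)) /
          (Nat.card {L : List Ef // IsEulerList Gf of zf L} : ℝ≥0∞)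

section WUA
open Classical

variable {V E : Type} (G : DigraphStruct V E)

/-- Laplacian with allowed outgoing edges `c`, Dirichlet boundary conditions off `U`. -/
noncomputable def lap (c : V → Finset E) (U : Finset V) : Matrix U U ℝ :=
  fun u w => ∑ e ∈ c u, ((if u = w then 1 else 0) - (if G.dst e = w then 1 else 0))

/-- The map following `f` on `U` and stopping off `U`. -/
noncomputable def gstep (U : Finset V) (f : U → E) (v : V) : V :=
  if h : v ∈ U then G.dst (f ⟨v, h⟩) else v

def Esc (U : Finset V) (f : U → E) : Prop := ∀ v, ∃ k, (gstep G U f)^[k] v ∉ U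

noncomputable def rowM (U : Finset V) (f : U → E) : Matrix U U ℝ :=
  fun u w => (if u = w then 1 else 0) - (if G.dst (f u) = w then 1 else 0)

lemma det_rowM_esc (U : Finset V) (f : U → E) (h : Esc G U f) : (rowM G U f).det = 1 := by
  let r : V → ℕ := fun v => Nat.find (h v)
  have hr : ∀ u : U, r (G.dst (f u)) < r u := by
    intro u
    have h1 := Nat.find_spec (h u)
    have h2 : Nat.find (h u) ≠ 0 := by
      intro h0
      rw [h0] at h1
      exact h1 u.2
    obtain ⟨k, hk⟩ := Nat.exists_eq_succ_of_ne_zero h2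
    rw [hk, Function.iterate_succ_apply] at h1
    have : gstep G U f u = G.dst (f u) := by simp [gstep]
    rw [this] at h1
    have h3 : r (G.dst (f u)) ≤ k := Nat.find_min' _ h1
    have h4 : r u = k + 1 := hk
    omega
  have hT : (rowM G U f).BlockTriangular (fun u : U => OrderDual.toDual (r u)) := by
    intro i j hij
    have hij' : r i < r j := hij
    have h1 : i ≠ j := by rintro rfl; exact lt_irrefl _ hij'
    have h2 : G.dst (f i) ≠ j := by
      intro h2
      have := hr i
      rw [h2] at this
      omega
    simp [rowM, h1, h2]
  rw [hT.det]
  apply Finset.prod_eq_one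
  intro a _
  have : (rowM G U f).toSquareBlock (fun u : U => OrderDual.toDual (r u)) a = 1 := by
    ext i j
    have hij : r i.1 = r j.1 := by
      have := i.2.trans j.2.symm
      exact this
    have h2 : G.dst (f i.1) ≠ j.1 := by
      intro h2
      have := hr i.1
      rw [h2] at this
      omega
    have h3 : (i.1 = j.1) ↔ (i = j) := Subtype.ext_iff.symm
    simp only [Matrix.toSquareBlock_def, Matrix.of_apply, rowM, Matrix.one_apply, h3, if_neg h2, sub_zero]
  rw [this, Matrix.det_one]

lemma det_rowM_not_esc (U : Finset V) (f : U → E) (h : ¬ Esc G U f) :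
    (rowM G U f).det = 0 := by
  unfold Esc at h
  push Not at h
  obtain ⟨v, hv⟩ := h
  let C : V → Prop := fun v => ∀ k, (gstep G U f)^[k] v ∈ U
  have hCU : ∀ v, C v → v ∈ U := fun v hv => hv 0
  have hC : ∀ u : U, C u ↔ C (G.dst (f u)) := by
    intro u
    have : gstep G U f u = G.dst (f u) := by simp [gstep]
    constructor
    · intro h k
      have := h (k+1)
      rwa [Function.iterate_succ_apply, ‹gstep G U f u = _›] at this
    · intro h k
      cases k with
      | zero => exact u.2
      | succ k => rw [Function.iterate_succ_apply, this]; exact h k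
  apply Matrix.exists_mulVec_eq_zero_iff.1
  refine ⟨fun u : U => if C u then 1 else 0, ?_, ?_⟩
  · intro h0
    have := congrFun h0 ⟨v, hv 0⟩
    simp only [Pi.zero_apply] at this
    rw [if_pos hv] at this
    exact one_ne_zero this
  · ext u
    have key : ∀ x : V, ∑ w : U, (if x = w then (1:ℝ) else 0) * (if C w then 1 else 0)
        = if C x then 1 else 0 := by
      intro x
      by_cases hx : x ∈ U
      · rw [Finset.sum_eq_single (⟨x, hx⟩ : U)]
        · simp
        · intro b _ hb
          have : x ≠ b := by rintro rfl; exact hb rfl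
          simp [this]
        · simp
      · rw [if_neg (fun h => hx (hCU x h))]
        apply Finset.sum_eq_zero
        intro w _
        have : x ≠ w := by rintro rfl; exact hx w.2
        simp [this]
    simp only [Matrix.mulVec, dotProduct, rowM, sub_mul, Finset.sum_sub_distrib, Pi.zero_apply]
    have k1 := key u
    have k2 := key (G.dst (f u))
    simp only [Subtype.ext_iff] at *
    rw [k1, k2]
    simp [hC u]

lemma det_lap (c : V → Finset E) (U : Finset V) :
    (lap G c U).det =
      (((Fintype.piFinset (fun u : U => c u)).filter (Esc G U)).card : ℝ) := by
  have h1 : (lap G c U).det = ∑ f ∈ Fintype.piFinset (fun u : U => c u), (rowM G U f).det := by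
    have := (Matrix.detRowAlternating (n := U) (R := ℝ)).toMultilinearMap.map_sum_finset
      (fun (u : U) (e : E) => fun w : U =>
        ((if u = w then (1:ℝ) else 0) - (if G.dst e = w then 1 else 0))) (fun u : U => c u)
    refine Eq.trans ?_ this
    change Matrix.det _ = Matrix.det _
    congr 1
    ext u w
    simp [lap, Finset.sum_apply]
  rw [h1, Finset.card_filter]
  push_cast
  apply Finset.sum_congr rfl
  intro f _
  split_ifs with h
  · exact det_rowM_esc G U f h
  · exact det_rowM_not_esc G U f h

/-- Outgoing edges compatible with containing `F`. -/
noncomputable def outC (out : V → Finset E) (F : Finset E) (v : V) : Finset E :=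
  (out v).filter (fun e => ∀ e' ∈ F, G.src e' = v → e' = e)

lemma card_wired (out : V → Finset E) (hout : ∀ v e, e ∈ out v ↔ G.src e = v)
    (U : Finset V) (F : Finset E) (hF : ∀ e ∈ F, G.src e ∈ U) :
    Nat.card {B : Set E // IsWiredArb G (U : Set V) B ∧ (F : Set E) ⊆ B} =
      ((Fintype.piFinset (fun u : U => outC G out F u)).filter (Esc G U)).card := by
  have hsrc : ∀ f ∈ (Fintype.piFinset (fun u : U => outC G out F u)).filter (Esc G U),
      ∀ u : U, G.src (f u) = u := by
    intro f hf u
    have := (Finset.mem_filter.1 ((Fintype.mem_piFinset.1 (Finset.mem_filter.1 hf).1) u)).1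
    exact (hout _ _).1 this
  symm
  rw [← Nat.card_eq_finsetCard]
  have hstep : ∀ (f : U → E) (hs : ∀ u : U, G.src (f u) = u) (a b : V),
      G.step (Set.range f) a b → ∃ h : a ∈ U, G.dst (f ⟨a, h⟩) = b := by
    rintro f hs a b ⟨e, ⟨u, rfl⟩, h1, h2⟩
    have : (u : V) = a := (hs u).symm.trans h1
    subst this
    exact ⟨u.2, h2⟩
  have hesc1 : ∀ (f : U → E) (hs : ∀ u : U, G.src (f u) = u), Esc G U f →
      ∀ v, ∃ v', v' ∉ (U : Set V) ∧ Relation.ReflTransGen (G.step (Set.range f)) v v' := by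
    intro f hs h v
    obtain ⟨k, hk⟩ := h v
    induction k generalizing v with
    | zero => exact ⟨v, hk, .refl⟩
    | succ k ih =>
      rw [Function.iterate_succ_apply] at hk
      by_cases hv : v ∈ U
      · obtain ⟨v', h1, h2⟩ := ih _ hk
        refine ⟨v', h1, .head ?_ h2⟩
        exact ⟨f ⟨v, hv⟩, ⟨_, rfl⟩, hs _, by simp [gstep, hv]⟩
      · exact ⟨v, hv, .refl⟩
  have hesc2 : ∀ (f : U → E) (hs : ∀ u : U, G.src (f u) = u),
      (∀ v ∈ (U : Set V), ∃ v', v' ∉ (U : Set V) ∧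
        Relation.ReflTransGen (G.step (Set.range f)) v v') → Esc G U f := by
    intro f hs h v
    by_cases hv : v ∈ U
    · obtain ⟨v', h1, h2⟩ := h v hv
      clear hv
      induction h2 using Relation.ReflTransGen.head_induction_on with
      | refl => exact ⟨0, h1⟩
      | head h3 _ ih =>
        obtain ⟨k, hk⟩ := ih
        obtain ⟨h4, h5⟩ := hstep f hs _ _ h3
        refine ⟨k + 1, ?_⟩
        rw [Function.iterate_succ_apply]
        simpa [gstep, h4, h5] using hk
    · exact ⟨0, hv⟩
  refine Nat.card_eq_of_bijective
    (fun f => ⟨Set.range f.1, ⟨?_, ?_, ?_⟩, ?_⟩) ⟨?_, ?_⟩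
  · rintro e ⟨u, rfl⟩
    rw [hsrc f.1 f.2 u]
    exact u.2
  · intro v hv
    refine ⟨f.1 ⟨v, hv⟩, ⟨⟨_, rfl⟩, hsrc f.1 f.2 _⟩, ?_⟩
    rintro e ⟨⟨u, rfl⟩, h⟩
    have : u = ⟨v, hv⟩ := Subtype.ext ((hsrc f.1 f.2 u).symm.trans h)
    rw [this]
  · intro v _
    exact hesc1 f.1 (hsrc f.1 f.2) (Finset.mem_filter.1 f.2).2 v
  · intro e he
    refine ⟨⟨G.src e, hF e he⟩, ?_⟩
    have := (Finset.mem_filter.1 ((Fintype.mem_piFinset.1 (Finset.mem_filter.1 f.2).1)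
      ⟨G.src e, hF e he⟩)).2
    exact (this e he rfl).symm
  · intro f g hfg
    have h : Set.range f.1 = Set.range g.1 := congrArg Subtype.val hfg
    apply Subtype.ext
    funext u
    have h1 : f.1 u ∈ Set.range g.1 := h ▸ ⟨u, rfl⟩
    obtain ⟨w, hw⟩ := h1
    have : w = u := Subtype.ext (by rw [← hsrc g.1 g.2 w, hw, hsrc f.1 f.2 u])
    rw [← hw, this]
  · rintro ⟨B, ⟨hB1, hB2, hB3⟩, hB4⟩
    choose f hf hf' using fun u : U => hB2 u u.2
    have hr : Set.range f = B := by
      ext e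
      constructor
      · rintro ⟨u, rfl⟩; exact (hf u).1
      · intro he
        exact ⟨⟨G.src e, hB1 e he⟩, (hf' ⟨G.src e, hB1 e he⟩ e ⟨he, rfl⟩).symm⟩
    refine ⟨⟨f, ?_⟩, Subtype.ext hr⟩
    rw [Finset.mem_filter, Fintype.mem_piFinset]
    refine ⟨fun u => ?_, hesc2 f (fun u => (hf u).2) ?_⟩
    · simp only [outC, Finset.mem_filter]
      refine ⟨(hout _ _).2 (hf u).2, fun e' he' h => hf' u e' ⟨hB4 he', h⟩⟩
    · rw [hr]; exact hB3

/-- Extension by zero of a matrix on `U`. -/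
noncomputable def ext0 (U : Finset V) (N : Matrix U U ℝ) (u w : V) : ℝ :=
  if h : u ∈ U ∧ w ∈ U then N ⟨u, h.1⟩ ⟨w, h.2⟩ else 0

lemma lap_mul (c : V → Finset E) (U : Finset V) (N : Matrix U U ℝ) (u w : U) :
    (lap G c U * N) u w = ∑ e ∈ c u, (ext0 U N u w - ext0 U N (G.dst e) w) := by
  have key : ∀ x : V, ∑ y : U, (if x = y then (1:ℝ) else 0) * N y w = ext0 U N x w := by
    intro x
    by_cases hx : x ∈ U
    · rw [Finset.sum_eq_single (⟨x, hx⟩ : U)]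
      · simp [ext0, hx]
      · intro b _ hb
        have : x ≠ b := by rintro rfl; exact hb rfl
        simp [this]
      · simp
    · rw [ext0, dif_neg (fun h => hx h.1)]
      apply Finset.sum_eq_zero
      intro y _
      have : x ≠ y := by rintro rfl; exact hx y.2
      simp [this]
  rw [Matrix.mul_apply]
  simp only [lap, Finset.sum_mul]
  rw [Finset.sum_comm]
  apply Finset.sum_congr rfl
  intro e _
  rw [← key, ← key, ← Finset.sum_sub_distrib]
  apply Finset.sum_congr rfl
  intro y _
  have h3 : (u = y) ↔ ((u : V) = y) := Subtype.ext_iff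
  simp only [sub_mul, h3]

lemma maxp (out : V → Finset E)
    (hesc : ∀ M : Finset V, M.Nonempty → ∃ u ∈ M, ∃ e ∈ out u, G.dst e ∉ M)
    (x : V → ℝ) (U : Finset V) (h0 : ∀ v ∉ U, 0 ≤ x v)
    (h : ∀ u ∈ U, 0 ≤ ∑ e ∈ out u, (x u - x (G.dst e))) (v : V) : 0 ≤ x v := by
  by_contra hv
  push Not at hv
  have hvU : v ∈ U := by
    by_contra h1
    exact absurd (h0 v h1) (not_le.2 hv)
  obtain ⟨u0, hu0, hmin⟩ := U.exists_min_image x ⟨v, hvU⟩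
  have hm : x u0 < 0 := (hmin v hvU).trans_lt hv
  have hall : ∀ y, x u0 ≤ x y := by
    intro y
    by_cases hy : y ∈ U
    · exact hmin y hy
    · exact hm.le.trans (h0 y hy)
  obtain ⟨u, hu, e, he, hd⟩ := hesc (U.filter (fun y => x y = x u0)) ⟨u0, by simp [hu0]⟩
  rw [Finset.mem_filter] at hu
  apply hd
  have hsum : ∑ e ∈ out u, (x u - x (G.dst e)) = 0 := by
    apply le_antisymm _ (h u hu.1)
    apply Finset.sum_nonpos
    intro e _
    have := hall (G.dst e)
    linarith [hu.2]
  have h2 := (Finset.sum_eq_zero_iff_of_nonpos (fun e _ => by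
    have := hall (G.dst e)
    linarith [hu.2])).1 hsum e he
  have h3 : x (G.dst e) = x u0 := by linarith [hu.2]
  rw [Finset.mem_filter]
  refine ⟨?_, h3⟩
  by_contra h4
  have := h0 _ h4
  linarith

lemma det_lap_ne (out : V → Finset E)
    (hesc : ∀ M : Finset V, M.Nonempty → ∃ u ∈ M, ∃ e ∈ out u, G.dst e ∉ M)
    (U : Finset V) : (lap G out U).det ≠ 0 := by
  intro h0
  obtain ⟨x, hx0, hx⟩ := Matrix.exists_mulVec_eq_zero_iff.2 h0
  let X : V → ℝ := fun v => if h : v ∈ U then x ⟨v, h⟩ else 0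
  have key : ∀ u ∈ U, ∑ e ∈ out u, (X u - X (G.dst e)) = 0 := by
    intro u hu
    have h1 := lap_mul G out U (Matrix.of fun y _ => x y : Matrix U U ℝ) ⟨u, hu⟩ ⟨u, hu⟩
    have h2 : (lap G out U * (Matrix.of fun y _ => x y : Matrix U U ℝ)) ⟨u, hu⟩ ⟨u, hu⟩ = 0 := by
      have := congrFun hx ⟨u, hu⟩
      simpa [Matrix.mul_apply, Matrix.mulVec, dotProduct] using this
    rw [h2] at h1
    rw [h1]
    apply Finset.sum_congr rfl
    intro e _
    simp [X, ext0, hu]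
  have hX0 : ∀ v ∉ U, X v = 0 := fun v hv => by simp [X, hv]
  have p1 := maxp G out hesc X U (fun v hv => (hX0 v hv).ge) (fun u hu => (key u hu).ge)
  have p2 := maxp G out hesc (fun v => - X v) U (fun v hv => by simp [hX0 v hv]) (fun u hu => by
    have := key u hu
    have h3 : ∑ e ∈ out u, (-X u - -X (G.dst e)) = - ∑ e ∈ out u, (X u - X (G.dst e)) := by
      rw [← Finset.sum_neg_distrib]
      apply Finset.sum_congr rfl
      intros; ring
    change 0 ≤ ∑ e ∈ out u, (-X u - -X (G.dst e))
    rw [h3, this]; simp)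
  apply hx0
  funext u
  have := p1 u
  have h4 := p2 u
  have h5 : X u = x u := by simp [X]
  simp only [Pi.zero_apply]
  linarith

/-- Green function of the walk killed off `U`. -/
noncomputable def green (out : V → Finset E) (U : Finset V) (u w : V) : ℝ :=
  ext0 U (lap G out U)⁻¹ u w

lemma green_eq (out : V → Finset E)
    (hesc : ∀ M : Finset V, M.Nonempty → ∃ u ∈ M, ∃ e ∈ out u, G.dst e ∉ M)
    (U : Finset V) (u w : V) (hu : u ∈ U) (hw : w ∈ U) :
    ∑ e ∈ out u, (green G out U u w - green G out U (G.dst e) w) = if u = w then 1 else 0 := by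
  have h1 := lap_mul G out U (lap G out U)⁻¹ ⟨u, hu⟩ ⟨w, hw⟩
  rw [Matrix.mul_nonsing_inv _ (isUnit_iff_ne_zero.2 (det_lap_ne G out hesc U))] at h1
  simp only [green]
  rw [← h1, Matrix.one_apply]
  simp

lemma green_off (out : V → Finset E) (U : Finset V) (u w : V) (h : ¬ (u ∈ U ∧ w ∈ U)) : green G out U u w = 0 := by
  simp only [green, ext0]
  rw [dif_neg h]

lemma green_nonneg (out : V → Finset E)
    (hesc : ∀ M : Finset V, M.Nonempty → ∃ u ∈ M, ∃ e ∈ out u, G.dst e ∉ M)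
    (U : Finset V) (u w : V) : 0 ≤ green G out U u w := by
  by_cases hw : w ∈ U
  · refine maxp G out hesc (fun u => green G out U u w) U ?_ ?_ u
    · intro v hv
      exact (green_off G out U v w (fun h => hv h.1)).ge
    · intro u hu
      refine le_of_le_of_eq ?_ (green_eq G out hesc U u w hu hw).symm
      split_ifs <;> simp
  · exact (green_off G out U u w (fun h => hw h.2)).ge

lemma green_mono (out : V → Finset E)
    (hesc : ∀ M : Finset V, M.Nonempty → ∃ u ∈ M, ∃ e ∈ out u, G.dst e ∉ M)
    (u w : V) : Monotone (fun U => green G out U u w) := by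
  intro U U' hUU
  by_cases hw : w ∈ U
  · have := maxp G out hesc (fun u => green G out U' u w - green G out U u w) U ?_ ?_ u
    · simpa using this
    · intro v hv
      refine le_of_le_of_eq ?_ (congrArg (_ - ·) (green_off G out U v w (fun h => hv h.1))).symm
      rw [sub_zero]
      exact green_nonneg G out hesc U' v w
    · intro u hu
      have h1 := green_eq G out hesc U u w hu hw
      have h2 := green_eq G out hesc U' u w (hUU hu) (hUU hw)
      have : ∑ e ∈ out u, (green G out U' u w - green G out U u w -
          (green G out U' (G.dst e) w - green G out U (G.dst e) w)) = 0 := by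
        rw [← sub_self (if u = w then (1:ℝ) else 0)]
        nth_rewrite 1 [← h2]
        rw [← h1, ← Finset.sum_sub_distrib]
        apply Finset.sum_congr rfl
        intros; ring
      exact this.ge
  · simp only []
    rw [green_off G out U u w (fun h => hw h.2)]
    exact green_nonneg G out hesc U' u w

lemma green_source (out : V → Finset E)
    (hesc : ∀ M : Finset V, M.Nonempty → ∃ u ∈ M, ∃ e ∈ out u, G.dst e ∉ M)
    (hout : ∀ v e, e ∈ out v ↔ G.src e = v)
    (inn : V → Finset E) (hin : ∀ v e, e ∈ inn v ↔ G.dst e = v) (o : V)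
    (hbal : ∀ v, v ≠ o → (inn v).card = (out v).card) (hso : (out o).card = (inn o).card + 1)
    (U : Finset V) (w : V) : green G out U o w ≤ 1 := by
  by_cases ho : o ∈ U ∧ w ∈ U
  swap
  · rw [green_off G out U o w ho]; exact zero_le_one
  obtain ⟨ho, hw⟩ := ho
  set g : V → ℝ := fun v => green G out U v w with hg
  have gn : ∀ v, 0 ≤ g v := fun v => green_nonneg G out hesc U v w
  have h1 : ∑ u ∈ U, ∑ e ∈ out u, (g u - g (G.dst e)) = 1 := by
    have : ∀ u ∈ U, ∑ e ∈ out u, (g u - g (G.dst e)) = if u = w then 1 else 0 :=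
      fun u hu => green_eq G out hesc U u w hu hw
    rw [Finset.sum_congr rfl this]
    simp [hw]
  have h2 : ∑ u ∈ U, ∑ e ∈ out u, g (G.dst e) ≤ ∑ v ∈ U, (inn v).card * g v := by
    rw [← Finset.sum_biUnion (s := U) (t := out) (f := fun e => g (G.dst e))]
    swap
    · intro a _ b _ hab
      rw [Function.onFun, Finset.disjoint_left]
      intro e h1 h2
      exact hab (((hout _ _).1 h1).symm.trans ((hout _ _).1 h2))
    rw [← Finset.sum_filter_add_sum_filter_not _ (fun e => G.dst e ∈ U)]
    have hz : ∑ e ∈ (U.biUnion out).filter (fun e => ¬ G.dst e ∈ U), g (G.dst e) = 0 := by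
      apply Finset.sum_eq_zero
      intro e he
      exact green_off G out U _ w (fun h => (Finset.mem_filter.1 he).2 h.1)
    rw [hz, add_zero]
    rw [← Finset.sum_fiberwise_of_maps_to (g := G.dst) (t := U)
      (fun e he => (Finset.mem_filter.1 he).2)]
    apply Finset.sum_le_sum
    intro v _
    rw [Finset.sum_congr rfl (g := fun _ => g v)
      (fun e he => by rw [(Finset.mem_filter.1 he).2])]
    rw [Finset.sum_const, nsmul_eq_mul]
    apply mul_le_mul_of_nonneg_right _ (gn v)
    exact_mod_cast Finset.card_le_card (fun e he => (hin v e).2 (Finset.mem_filter.1 he).2)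
  have h3 : ∑ u ∈ U, ∑ e ∈ out u, (g u - g (G.dst e))
      = ∑ u ∈ U, (out u).card * g u - ∑ u ∈ U, ∑ e ∈ out u, g (G.dst e) := by
    rw [← Finset.sum_sub_distrib]
    apply Finset.sum_congr rfl
    intro u _
    rw [Finset.sum_sub_distrib, Finset.sum_const, nsmul_eq_mul]
  have h4 : ∑ u ∈ U, ((out u).card : ℝ) * g u - ∑ v ∈ U, ((inn v).card : ℝ) * g v = g o := by
    rw [← Finset.sum_sub_distrib, Finset.sum_eq_single o]
    · rw [hso]; push_cast; ring
    · intro b _ hb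
      rw [hbal b hb]; ring
    · intro h; exact absurd ho h
  change g o ≤ 1
  linarith

lemma green_step (out : V → Finset E)
    (hesc : ∀ M : Finset V, M.Nonempty → ∃ u ∈ M, ∃ e ∈ out u, G.dst e ∉ M)
    (hout : ∀ v e, e ∈ out v ↔ G.src e = v) (e : E) (w : V) (C : ℝ)
    (hC : ∀ U, green G out U (G.src e) w ≤ C) (U : Finset V) :
    green G out U (G.dst e) w ≤ (out (G.src e)).card * C := by
  have h1 : green G out U (G.dst e) w ≤ green G out (insert (G.src e) U) (G.dst e) w :=
    green_mono G out hesc _ _ (Finset.subset_insert _ _)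
  refine h1.trans ?_
  set U' := insert (G.src e) U
  have hsU : G.src e ∈ U' := Finset.mem_insert_self _ _
  have hC0 : 0 ≤ C := (green_nonneg G out hesc U _ w).trans (hC U)
  by_cases hw : w ∈ U'
  · have h2 := green_eq G out hesc U' (G.src e) w hsU hw
    rw [Finset.sum_sub_distrib, Finset.sum_const, nsmul_eq_mul] at h2
    have h3 : green G out U' (G.dst e) w ≤ ∑ e' ∈ out (G.src e), green G out U' (G.dst e') w :=
      Finset.single_le_sum (f := fun e' => green G out U' (G.dst e') w)
        (fun e' _ => green_nonneg G out hesc U' _ w) ((hout _ _).2 rfl)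
    have h4 : (0:ℝ) ≤ if G.src e = w then 1 else 0 := by split_ifs <;> simp
    have h5 : ((out (G.src e)).card : ℝ) * green G out U' (G.src e) w ≤
        (out (G.src e)).card * C := by
      gcongr
      exact hC U'
    linarith
  · rw [green_off G out U' _ w (fun h => hw h.2)]
    positivity

lemma wired_limit (out : V → Finset E) (hout : ∀ v e, e ∈ out v ↔ G.src e = v)
    (inn : V → Finset E) (hin : ∀ v e, e ∈ inn v ↔ G.dst e = v) (o : V)
    (hbal : ∀ v, v ≠ o → (inn v).card = (out v).card) (hso : (out o).card = (inn o).card + 1)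
    (hesc : ∀ M : Finset V, M.Nonempty → ∃ u ∈ M, ∃ e ∈ out u, G.dst e ∉ M)
    (γ : ℕ → E) (hγ : ∀ i, G.dst (γ i) = G.src (γ (i + 1))) (hγ0 : G.src (γ 0) = o)
    (hvis : ∀ v, ∃ i, G.src (γ i) = v) (F : Finset E) :
    ∃ L : ℝ≥0∞, L ≠ ⊤ ∧
      Tendsto (fun U : Finset V => wiredUACyl G (U : Set V) F) atTop (nhds L) := by
  have hbd : ∀ w i, ∃ C, ∀ U, green G out U (G.src (γ i)) w ≤ C := by
    intro w i
    induction i with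
    | zero =>
      rw [hγ0]
      exact ⟨1, fun U => green_source G out hesc hout inn hin o hbal hso U w⟩
    | succ i ih =>
      obtain ⟨C, hC⟩ := ih
      rw [← hγ]
      exact ⟨_, green_step G out hesc hout (γ i) w C hC⟩
  have hlim : ∀ u w, ∃ l, Tendsto (fun U => green G out U u w) atTop (nhds l) := by
    intro u w
    obtain ⟨i, rfl⟩ := hvis u
    obtain ⟨C, hC⟩ := hbd w i
    exact ⟨_, tendsto_atTop_ciSup (green_mono G out hesc _ w)
      ⟨C, by rintro _ ⟨U, rfl⟩; exact hC U⟩⟩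
  choose h hh using hlim
  let K : Finset V := F.image G.src
  let M : (V → V → ℝ) → Matrix K K ℝ := fun g u w =>
    ∑ e ∈ outC G out F u, (g u w - g (G.dst e) w)
  have hM : ∀ U : Finset V, K ⊆ U →
      wiredUACyl G (U : Set V) F = ENNReal.ofReal (M (green G out U)).det := by
    intro U hKU
    have hF : ∀ e ∈ F, G.src e ∈ U := fun e he => hKU (Finset.mem_image_of_mem _ he)
    have c1 := card_wired G out hout U F hF
    have c2 := card_wired G out hout U ∅ (by simp)
    simp only [Finset.coe_empty, Set.empty_subset, and_true] at c2
    have d1 := det_lap G (outC G out F) U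
    have d2 := det_lap G (outC G out ∅) U
    have ho : outC G out ∅ = out := by funext v; simp [outC]
    rw [← c1] at d1
    rw [← c2, ho] at d2
    have hne := det_lap_ne G out hesc U
    have e1 : (M (green G out U)).det = (lap G (outC G out F) U).det / (lap G out U).det := by
      have e2 : (lap G (outC G out F) U).det / (lap G out U).det =
          (lap G (outC G out F) U * (lap G out U)⁻¹).det := by
        rw [Matrix.det_mul, Matrix.det_nonsing_inv, Ring.inverse_eq_inv', div_eq_mul_inv]
      rw [e2, Matrix.twoBlockTriangular_det _ (fun u : U => (u : V) ∈ K)]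
      · have hid : (Matrix.toSquareBlockProp (lap G (outC G out F) U * (lap G out U)⁻¹)
            (fun u : U => ¬ (u : V) ∈ K)) = 1 := by
          ext i j
          rw [Matrix.toSquareBlockProp_def, Matrix.of_apply, lap_mul]
          have : outC G out F i.1 = out i.1 := by
            unfold outC
            rw [Finset.filter_true_of_mem]
            intro e _ e' he' h'
            exact absurd (h' ▸ Finset.mem_image_of_mem G.src he') i.2
          rw [this]
          have := green_eq G out hesc U i.1 j.1 i.1.2 j.1.2
          refine this.trans ?_
          have h3 : (i = j) ↔ (((i : U) : V) = (j : U)) := by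
            rw [Subtype.ext_iff, Subtype.ext_iff]
          simp only [Matrix.one_apply, h3]
        rw [hid, Matrix.det_one, mul_one]
        let eq : K ≃ {u : U // (u : V) ∈ K} :=
          ⟨fun k => ⟨⟨k, hKU k.2⟩, k.2⟩, fun u => ⟨u.1, u.2⟩, fun _ => rfl, fun _ => rfl⟩
        rw [← Matrix.det_submatrix_equiv_self eq]
        congr 1
        ext u w
        rw [Matrix.submatrix_apply, Matrix.toSquareBlockProp_def, Matrix.of_apply, lap_mul]
        rfl
      · intro i hi j hj
        rw [lap_mul]
        have : outC G out F i = out i := by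
          unfold outC
          rw [Finset.filter_true_of_mem]
          intro e _ e' he' h'
          exact absurd (h' ▸ Finset.mem_image_of_mem G.src he') hi
        rw [this]
        have := green_eq G out hesc U i j i.2 j.2
        refine this.trans (if_neg ?_)
        intro h
        exact hi (h ▸ hj)
    rw [e1, d1, d2, wiredUACyl]
    have hpos : (0:ℝ) < (Nat.card {B : Set E // IsWiredArb G (U : Set V) B} : ℝ) := by
      rw [d2] at hne
      exact lt_of_le_of_ne (Nat.cast_nonneg _) hne.symm
    rw [ENNReal.ofReal_div_of_pos hpos, ENNReal.ofReal_natCast, ENNReal.ofReal_natCast]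
  refine ⟨ENNReal.ofReal (M h).det, ENNReal.ofReal_ne_top, ?_⟩
  have ht : Tendsto (fun U => M (green G out U)) atTop (nhds (M h)) := by
    refine tendsto_pi_nhds.2 fun u => tendsto_pi_nhds.2 fun w => ?_
    exact tendsto_finsetSum _ (fun e _ => (hh _ _).sub (hh _ _))
  have ht2 := (ENNReal.continuous_ofReal.tendsto _).comp
    (((continuous_id.matrix_det (n := K) (R := ℝ)).tendsto _).comp ht)
  refine ht2.congr' ?_
  filter_upwards [eventually_ge_atTop K] with U hU
  exact (hM U hU).symm

end WUA

section BEST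
open Classical

variable {V E : Type} (G : DigraphStruct V E)

/-- Last-exit edges of a finite path, from vertices other than `z`. -/
noncomputable def LE (z : V) : List E → Finset E
  | [] => ∅
  | e :: P => if G.src e = z ∨ G.src e ∈ P.map G.src then LE z P else insert e (LE z P)

lemma LE_sub (z : V) (P : List E) : ∀ e ∈ LE G z P, e ∈ P := by
  induction P with
  | nil => simp [LE]
  | cons a P ih =>
    intro e he
    rw [LE] at he
    split_ifs at he with h
    · exact List.mem_cons_of_mem _ (ih e he)
    · rcases Finset.mem_insert.1 he with rfl | he
      · exact List.mem_cons_self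
      · exact List.mem_cons_of_mem _ (ih e he)

structure Arb (R : Finset E) (z : V) (T : Finset E) : Prop where
  sub : T ⊆ R
  nz : ∀ e ∈ T, G.src e ≠ z
  ex : ∀ e ∈ R, G.src e ≠ z → ∃ e' ∈ T, G.src e' = G.src e
  uniq : ∀ e ∈ T, ∀ e' ∈ T, G.src e = G.src e' → e = e'
  flow : ∀ e ∈ R, Relation.ReflTransGen (G.step (T : Set E)) (G.dst e) z

noncomputable def dO (R : Finset E) (v : V) : ℕ := (R.filter (fun e => G.src e = v)).card
noncomputable def dI (R : Finset E) (v : V) : ℕ := (R.filter (fun e => G.dst e = v)).card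

def Bal (R : Finset E) (o z : V) : Prop :=
  ∀ v, dI G R v + (if v = o then 1 else 0) = dO G R v + (if v = z then 1 else 0)

noncomputable def eul (R : Finset E) (o z : V) (T : Finset E) : Finset (List E) :=
  R.val.lists.toFinset.filter (fun P => IsPathList G o z P ∧ LE G z P = T)

noncomputable def cst (R : Finset E) (z : V) (W : Finset V) : ℕ :=
  ∏ v ∈ W, if v = z then (dO G R v).factorial else (dO G R v - 1).factorial

lemma mem_eul (R : Finset E) (o z : V) (T : Finset E) (P : List E) :
    P ∈ eul G R o z T ↔ R.val = (P : Multiset E) ∧ IsPathList G o z P ∧ LE G z P = T := by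
  rw [eul, Finset.mem_filter, Multiset.mem_toFinset, Multiset.mem_lists_iff]
  rfl

lemma mem_eul_cons (R : Finset E) (o z : V) (T : Finset E) (e : E) (P : List E) :
    e :: P ∈ eul G R o z T ↔ e ∈ R ∧ G.src e = o ∧ (R.erase e).val = (P : Multiset E) ∧
      IsPathList G (G.dst e) z P ∧ LE G z (e :: P) = T := by
  rw [mem_eul, IsPathList]
  have : R.val = ((e :: P : List E) : Multiset E) ↔
      e ∈ R ∧ (R.erase e).val = (P : Multiset E) := by
    rw [Finset.erase_val, ← Multiset.cons_coe]
    constructor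
    · intro h
      refine ⟨by rw [← Finset.mem_val, h]; simp, by rw [h]; simp⟩
    · rintro ⟨h1, h2⟩
      rw [← h2, Multiset.cons_erase h1]
  rw [this]
  tauto

lemma dO_erase_self (R : Finset E) (e : E) (he : e ∈ R) :
    dO G R (G.src e) = dO G (R.erase e) (G.src e) + 1 := by
  unfold dO
  rw [Finset.filter_erase, Finset.card_erase_add_one]
  simp [he]

lemma dO_erase_ne (R : Finset E) (e : E) (v : V) (hv : v ≠ G.src e) :
    dO G (R.erase e) v = dO G R v := by
  unfold dO
  rw [Finset.filter_erase, Finset.erase_eq_of_notMem]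
  simp [hv.symm]

lemma dI_erase_self (R : Finset E) (e : E) (he : e ∈ R) :
    dI G R (G.dst e) = dI G (R.erase e) (G.dst e) + 1 := by
  unfold dI
  rw [Finset.filter_erase, Finset.card_erase_add_one]
  simp [he]

lemma dI_erase_ne (R : Finset E) (e : E) (v : V) (hv : v ≠ G.dst e) :
    dI G (R.erase e) v = dI G R v := by
  unfold dI
  rw [Finset.filter_erase, Finset.erase_eq_of_notMem]
  simp [hv.symm]

lemma Bal_erase (R : Finset E) (z : V) (e : E) (he : e ∈ R) :
    Bal G R (G.src e) z ↔ Bal G (R.erase e) (G.dst e) z := by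
  unfold Bal
  apply forall_congr'
  intro v
  have h1 : dO G R v = dO G (R.erase e) v + if v = G.src e then 1 else 0 := by
    split_ifs with h
    · subst h; exact dO_erase_self G R e he
    · rw [dO_erase_ne G R e v h]; rfl
  have h2 : dI G R v = dI G (R.erase e) v + if v = G.dst e then 1 else 0 := by
    split_ifs with h
    · subst h; exact dI_erase_self G R e he
    · rw [dI_erase_ne G R e v h]; rfl
  rw [h1, h2]
  omega

lemma dO_pos_iff (R : Finset E) (v : V) : 0 < dO G R v ↔ ∃ e ∈ R, G.src e = v := by
  unfold dO
  rw [Finset.card_pos]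
  constructor
  · rintro ⟨e, he⟩; exact ⟨e, Finset.mem_filter.1 he⟩
  · rintro ⟨e, he⟩; exact ⟨e, Finset.mem_filter.2 he⟩

lemma dI_pos_iff (R : Finset E) (v : V) : 0 < dI G R v ↔ ∃ e ∈ R, G.dst e = v := by
  unfold dI
  rw [Finset.card_pos]
  constructor
  · rintro ⟨e, he⟩; exact ⟨e, Finset.mem_filter.1 he⟩
  · rintro ⟨e, he⟩; exact ⟨e, Finset.mem_filter.2 he⟩

lemma cst_erase (R : Finset E) (z : V) (W : Finset V) (e : E) (hW : G.src e ∈ W) :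
    cst G (R.erase e) z W =
      (if G.src e = z then (dO G (R.erase e) (G.src e)).factorial
        else (dO G (R.erase e) (G.src e) - 1).factorial) *
      ∏ v ∈ W.erase (G.src e), if v = z then (dO G R v).factorial
        else (dO G R v - 1).factorial := by
  unfold cst
  rw [← Finset.mul_prod_erase _ _ hW]
  congr 1
  apply Finset.prod_congr rfl
  intro v hv
  rw [dO_erase_ne G R e v (Finset.ne_of_mem_erase hv)]

theorem best (z : V) (W : Finset V) (R : Finset E) : ∀ (o : V) (T : Finset E), Bal G R o z →
    Arb G R z T → R.image G.src ⊆ W → (eul G R o z T).card = cst G R z W := by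
  induction R using Finset.strongInduction with
  | H R ih =>
  intro o T hb hT hW
  rcases R.eq_empty_or_nonempty with rfl | hne
  · have hoz : o = z := by
      have := hb o
      by_contra h
      simp [dI, dO, h] at this
    have hT0 : T = ∅ := Finset.subset_empty.1 hT.sub
    have : eul G ∅ o z T = {[]} := by
      ext P
      rw [mem_eul, Finset.mem_singleton]
      constructor
      · rintro ⟨h, -⟩
        simpa [eq_comm] using h
      · rintro rfl
        refine ⟨rfl, hoz, by rw [hT0]; rfl⟩
    rw [this]
    simp [cst, dO]
  -- nonempty case: o has an outgoing edge
  have hdo : 0 < dO G R o := by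
    by_contra h0
    have hb' := hb o
    by_cases hoz : o = z
    · subst hoz
      have hI : ¬ 0 < dI G R o := by simp at hb'; omega
      rw [dI_pos_iff] at hI
      obtain ⟨e, he⟩ := hne
      rcases (hT.flow e he).cases_tail with h | ⟨c, _, e', he', _, h2⟩
      · exact hI ⟨e, he, h.symm⟩
      · exact hI ⟨e', hT.sub he', h2⟩
    · simp [hoz] at hb'
      omega
  have hoW : o ∈ W := by
    obtain ⟨e, he, rfl⟩ := (dO_pos_iff G R o).1 hdo
    exact hW (Finset.mem_image_of_mem _ he)
  have hWe : ∀ e, (R.erase e).image G.src ⊆ W := fun e =>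
    (Finset.image_subset_image (Finset.erase_subset _ _)).trans hW
  -- general assembling lemma
  have assemble : ∀ (A : Finset E) (T' : Finset E) (k : ℕ),
      (∀ e ∈ A, e ∈ R ∧ G.src e = o) →
      (∀ e (P : List E), e ∈ R → G.src e = o → (R.erase e).val = (P : Multiset E) →
        (LE G z (e :: P) = T ↔ e ∈ A ∧ LE G z P = T')) →
      (∀ e ∈ A, Arb G (R.erase e) z T') →
      (∀ e ∈ A, cst G (R.erase e) z W = k) →
      (eul G R o z T).card = A.card * k := by
    intro A T' k hA hLE hArb hk
    have hun : eul G R o z T =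
        A.biUnion (fun e => (eul G (R.erase e) (G.dst e) z T').image (List.cons e)) := by
      ext P
      rw [Finset.mem_biUnion]
      constructor
      · intro hP
        cases P with
        | nil =>
          rw [mem_eul] at hP
          have := hP.1
          simp at this
          exact absurd this hne.ne_empty
        | cons e P =>
          rw [mem_eul_cons] at hP
          obtain ⟨h1, h2, h3, h4, h5⟩ := hP
          obtain ⟨h6, h7⟩ := (hLE e P h1 h2 h3).1 h5
          exact ⟨e, h6, Finset.mem_image_of_mem _ ((mem_eul _ _ _ _ _ _).2 ⟨h3, h4, h7⟩)⟩
      · rintro ⟨e, he, hP⟩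
        obtain ⟨P', hP', rfl⟩ := Finset.mem_image.1 hP
        obtain ⟨h3, h4, h5⟩ := (mem_eul _ _ _ _ _ _).1 hP'
        obtain ⟨h1, h2⟩ := hA e he
        rw [mem_eul_cons]
        exact ⟨h1, h2, h3, h4, (hLE e P' h1 h2 h3).2 ⟨he, h5⟩⟩
    rw [hun, Finset.card_biUnion]
    · rw [Finset.sum_congr rfl (g := fun _ => k)]
      · simp
      · intro e he
        obtain ⟨h1, h2⟩ := hA e he
        rw [Finset.card_image_of_injective _ (List.cons_injective), ← hk e he]
        refine ih _ (Finset.erase_ssubset h1) _ _ ?_ (hArb e he) (hWe e)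
        rw [← Bal_erase G R z e h1, h2]
        exact hb
    · intro a _ b _ hab
      rw [Function.onFun, Finset.disjoint_left]
      intro P h1 h2
      obtain ⟨_, _, rfl⟩ := Finset.mem_image.1 h1
      obtain ⟨_, _, h3⟩ := Finset.mem_image.1 h2
      exact hab (List.cons.inj h3).1.symm
  have hrest : cst G R z W = (if o = z then (dO G R o).factorial
        else (dO G R o - 1).factorial) *
      ∏ v ∈ W.erase o, if v = z then (dO G R v).factorial
        else (dO G R v - 1).factorial := by
    unfold cst
    rw [← Finset.mul_prod_erase _ _ hoW]
  set rest := ∏ v ∈ W.erase o, if v = z then (dO G R v).factorial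
        else (dO G R v - 1).factorial with hrest_def
  have hmemsrc : ∀ e (P : List E), (R.erase e).val = (P : Multiset E) → G.src e = o → e ∈ R →
      (G.src e ∈ P.map G.src ↔ 2 ≤ dO G R o) := by
    intro e P hP he heR
    have h1 := dO_erase_self G R e heR
    rw [he] at h1
    have h2 := dO_pos_iff G (R.erase e) o
    have h3 : G.src e ∈ P.map G.src ↔ ∃ e' ∈ R.erase e, G.src e' = o := by
      rw [List.mem_map, he]
      apply exists_congr
      intro e'
      rw [← Finset.mem_val, hP, Multiset.mem_coe]
    rw [h3, ← h2]
    omega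
  have hcst : ∀ e ∈ R, G.src e = o → cst G (R.erase e) z W =
      (if o = z then (dO G R o - 1).factorial else (dO G R o - 1 - 1).factorial) * rest := by
    intro e he heo
    rw [cst_erase G R z W e (heo ▸ hoW), heo]
    have h1 := dO_erase_self G R e he
    rw [heo] at h1
    have h2 : dO G (R.erase e) o = dO G R o - 1 := by omega
    rw [h2]
  by_cases hoz : o = z
  · rw [assemble (R.filter (fun e => G.src e = o)) T ((dO G R o - 1).factorial * rest)]
    · rw [hrest, if_pos hoz, ← mul_assoc]
      congr 1
      exact Nat.mul_factorial_pred hdo.ne'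
    · intro e he; exact Finset.mem_filter.1 he
    · intro e P h1 h2 h3
      rw [LE, if_pos (Or.inl (h2.trans hoz))]
      simp [h1, h2]
    · intro e he
      obtain ⟨h1, h2⟩ := Finset.mem_filter.1 he
      refine ⟨?_, hT.nz, ?_, hT.uniq, ?_⟩
      · intro e' he'
        refine Finset.mem_erase.2 ⟨?_, hT.sub he'⟩
        rintro rfl
        exact hT.nz _ he' (h2.trans hoz)
      · intro e' he'; exact hT.ex e' (Finset.mem_of_mem_erase he')
      · intro e' he'; exact hT.flow e' (Finset.mem_of_mem_erase he')
    · intro e he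
      obtain ⟨h1, h2⟩ := Finset.mem_filter.1 he
      rw [hcst e h1 h2, if_pos hoz]
  · obtain ⟨e0, he0, he0o⟩ := (dO_pos_iff G R o).1 hdo
    obtain ⟨t, htT, hto⟩ := hT.ex e0 he0 (by rw [he0o]; exact hoz)
    rw [he0o] at hto
    by_cases hd : 2 ≤ dO G R o
    · rw [assemble ((R.filter (fun e => G.src e = o)).erase t) T
        ((dO G R o - 1 - 1).factorial * rest)]
      · rw [hrest, if_neg hoz, ← mul_assoc]
        congr 1
        rw [Finset.card_erase_of_mem (by simp [hT.sub htT, hto])]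
        exact Nat.mul_factorial_pred (by change dO G R o - 1 ≠ 0; omega)
      · intro e he; exact Finset.mem_filter.1 (Finset.mem_of_mem_erase he)
      · intro e P h1 h2 h3
        rw [LE, if_pos (Or.inr ((hmemsrc e P h3 h2 h1).2 hd))]
        rw [Finset.mem_erase, Finset.mem_filter]
        constructor
        · intro h
          refine ⟨⟨?_, h1, h2⟩, h⟩
          rintro rfl
          have h4 : e ∈ LE G z P := h ▸ htT
          have h5 := LE_sub G z P e h4
          rw [← Multiset.mem_coe, ← h3, Finset.mem_val] at h5
          exact Finset.notMem_erase _ _ h5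
        · exact fun h => h.2
      · intro e he
        obtain ⟨h0, h⟩ := Finset.mem_erase.1 he
        obtain ⟨h1, h2⟩ := Finset.mem_filter.1 h
        refine ⟨?_, hT.nz, ?_, hT.uniq, ?_⟩
        · intro e' he'
          refine Finset.mem_erase.2 ⟨?_, hT.sub he'⟩
          rintro rfl
          exact h0 (hT.uniq _ he' _ htT (h2.trans hto.symm))
        · intro e' he'; exact hT.ex e' (Finset.mem_of_mem_erase he')
        · intro e' he'; exact hT.flow e' (Finset.mem_of_mem_erase he')
      · intro e he
        obtain ⟨h0, h⟩ := Finset.mem_erase.1 he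
        obtain ⟨h1, h2⟩ := Finset.mem_filter.1 h
        rw [hcst e h1 h2, if_neg hoz]
    · have hd1 : dO G R o = 1 := by omega
      have hI0 : dI G R o = 0 := by
        have := hb o
        simp [hoz] at this
        omega
      have hnoin : ∀ e ∈ R, G.dst e ≠ o := by
        intro e he h
        have := (dI_pos_iff G R o).2 ⟨e, he, h⟩
        omega
      have honly : ∀ e ∈ R, G.src e = o → e = t := by
        intro e he heo
        have : (R.filter (fun e => G.src e = o)).card ≤ 1 := hd1.le
        exact Finset.card_le_one.1 this e (by simp [he, heo]) t (by simp [hT.sub htT, hto])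
      rw [assemble {t} (T.erase t) ((dO G R o - 1 - 1).factorial * rest)]
      · rw [hrest, if_neg hoz, hd1]
        simp
      · intro e he
        rw [Finset.mem_singleton] at he
        subst he
        exact ⟨hT.sub htT, hto⟩
      · intro e P h1 h2 h3
        have het := honly e h1 h2
        subst het
        have hn : e ∉ LE G z P := by
          intro h
          have h5 := LE_sub G z P e h
          rw [← Multiset.mem_coe, ← h3, Finset.mem_val] at h5
          exact Finset.notMem_erase _ _ h5
        rw [LE, if_neg]
        · simp only [Finset.mem_singleton, true_and]
          constructor
          · rintro rfl; rw [Finset.erase_insert hn]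
          · intro h; rw [h, Finset.insert_erase htT]
        · rintro (h | h)
          · exact hoz (h2.symm.trans h)
          · exact hd ((hmemsrc e P h3 h2 h1).1 h)
      · intro e he
        rw [Finset.mem_singleton] at he
        subst he
        refine ⟨Finset.erase_subset_erase _ hT.sub, fun e' he' => hT.nz e' (Finset.mem_of_mem_erase he'),
          ?_, fun a ha b hb => hT.uniq a (Finset.mem_of_mem_erase ha) b (Finset.mem_of_mem_erase hb),
          ?_⟩
        · intro e' he' hz
          obtain ⟨h1, h2⟩ := Finset.mem_erase.1 he'
          obtain ⟨a, ha, hae⟩ := hT.ex e' h2 hz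
          refine ⟨a, Finset.mem_erase.2 ⟨?_, ha⟩, hae⟩
          rintro rfl
          exact h1 (honly e' h2 (hae.symm.trans hto))
        · intro e' he'
          have h2 := Finset.mem_of_mem_erase he'
          have h3 := hT.flow e' h2
          have h4 := hnoin e' h2
          generalize G.dst e' = x at h3 h4
          induction h3 using Relation.ReflTransGen.head_induction_on with
          | refl => exact .refl
          | head h5 _ ih' =>
            obtain ⟨a, ha, ha1, ha2⟩ := h5
            refine .head ⟨a, ?_, ha1, ha2⟩ (ih' ?_)
            · rw [Finset.mem_coe, Finset.mem_erase]
              refine ⟨?_, ha⟩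
              rintro rfl
              exact h4 (ha1.symm.trans hto)
            · rw [← ha2]
              exact hnoin a (hT.sub ha)
      · intro e he
        rw [Finset.mem_singleton] at he
        subst he
        rw [hcst e (hT.sub htT) hto, if_neg hoz]

end BEST

section EXPL
open Classical

variable {V E : Type} (G : DigraphStruct V E)

/-- Vertices of `S` all of whose `T`-past is in `S`. -/
noncomputable def DS (S : Finset V) (T : Finset E) : Finset V :=
  S.filter (fun v => ∀ u, Relation.ReflTransGen (G.step (T : Set E)) u v → u ∈ S)

lemma DS_sub (S : Finset V) (T : Finset E) : DS G S T ⊆ S := Finset.filter_subset _ _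

lemma DS_past (S : Finset V) (T : Finset E) (e : E) (he : e ∈ T) (hd : G.dst e ∈ DS G S T) :
    G.src e ∈ DS G S T := by
  obtain ⟨h1, h2⟩ := Finset.mem_filter.1 hd
  have hs : G.step (T : Set E) (G.src e) (G.dst e) := ⟨e, he, rfl, rfl⟩
  refine Finset.mem_filter.2 ⟨h2 _ (.single hs), fun u hu => h2 u (hu.tail hs)⟩

noncomputable def swp (D : Finset V) (T t : Finset E) : Finset E :=
  T.filter (fun e => G.src e ∉ D) ∪ t

noncomputable def rst (D : Finset V) (T : Finset E) : Finset E :=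
  T.filter (fun e => G.src e ∈ D)

variable (R : Finset E) (z : V) (S : Finset V)

/-- The finite set `S` avoids `z` and all its outgoing edges are in `R`. -/
structure Vld : Prop where
  hzS : z ∉ S
  hSR : ∀ e, G.src e ∈ S → e ∈ R
  hSne : ∀ v ∈ S, ∃ e, G.src e = v

lemma rst_wired (hV : Vld G R z S) (T : Finset E) (hT : Arb G R z T) :
    IsWiredArb G (DS G S T : Set V) (rst G (DS G S T) T : Set E) := by
  have key : ∀ x, Relation.ReflTransGen (G.step (T : Set E)) x z →
      ∃ v', v' ∉ (DS G S T : Set V) ∧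
        Relation.ReflTransGen (G.step (rst G (DS G S T) T : Set E)) x v' := by
    intro x hx
    induction hx using Relation.ReflTransGen.head_induction_on with
    | refl => exact ⟨z, fun h => hV.hzS (DS_sub G S T h), .refl⟩
    | @head a b h _ ih =>
      by_cases ha : a ∈ DS G S T
      · obtain ⟨v', h1, h2⟩ := ih
        obtain ⟨e, he, rfl, he2⟩ := h
        exact ⟨v', h1, .head ⟨e, Finset.mem_coe.2 (Finset.mem_filter.2 ⟨he, ha⟩), rfl, he2⟩ h2⟩
      · exact ⟨a, ha, .refl⟩
  have hex : ∀ v ∈ DS G S T, ∃ e ∈ T, G.src e = v := by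
    intro v hv
    have hvS := DS_sub G S T hv
    obtain ⟨e, he⟩ := hV.hSne v hvS
    obtain ⟨e', h1, h2⟩ := hT.ex e (hV.hSR e (he ▸ hvS)) (by rintro h; exact hV.hzS (h ▸ he ▸ hvS))
    exact ⟨e', h1, h2.trans he⟩
  refine ⟨fun e he => (Finset.mem_filter.1 he).2, fun v hv => ?_, fun v hv => ?_⟩
  · obtain ⟨e, he, hev⟩ := hex v hv
    refine ⟨e, ⟨Finset.mem_coe.2 (Finset.mem_filter.2 ⟨he, hev ▸ hv⟩), hev⟩, ?_⟩
    rintro e' ⟨h1, h2⟩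
    exact hT.uniq e' (Finset.mem_filter.1 h1).1 e he (h2.trans hev.symm)
  · obtain ⟨e, he, hev⟩ := hex v hv
    exact key v (.head ⟨e, he, hev, rfl⟩ (hT.flow e (hT.sub he)))

lemma stay (T t : Finset E) (x y : V) (hxy : Relation.ReflTransGen (G.step (T : Set E)) x y)
    (hx : x ∉ DS G S T) :
    Relation.ReflTransGen (G.step (swp G (DS G S T) T t : Set E)) x y := by
  induction hxy using Relation.ReflTransGen.head_induction_on with
  | refl => exact .refl
  | head h _ ih =>
    obtain ⟨e, he, rfl, rfl⟩ := h
    refine .head ⟨e, ?_, rfl, rfl⟩ (ih fun h => hx (DS_past G S T e he h))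
    exact Finset.mem_coe.2 (Finset.mem_union_left _ (Finset.mem_filter.2 ⟨he, hx⟩))

lemma swp_arb (hV : Vld G R z S) (T t : Finset E) (hT : Arb G R z T)
    (ht : IsWiredArb G (DS G S T : Set V) (t : Set E)) :
    Arb G R z (swp G (DS G S T) T t) := by
  have htS : ∀ e ∈ t, G.src e ∈ DS G S T := fun e he => ht.1 e he
  have htR : ∀ e ∈ t, e ∈ R := fun e he => hV.hSR e (DS_sub G S T (htS e he))
  refine ⟨?_, ?_, ?_, ?_, ?_⟩
  · intro e he
    rcases Finset.mem_union.1 he with h | h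
    · exact hT.sub (Finset.mem_filter.1 h).1
    · exact htR e h
  · intro e he
    rcases Finset.mem_union.1 he with h | h
    · exact hT.nz e (Finset.mem_filter.1 h).1
    · rintro rfl
      exact hV.hzS (DS_sub G S T (htS e h))
  · intro e he hez
    by_cases hD : G.src e ∈ DS G S T
    · obtain ⟨e', ⟨h1, h2⟩, _⟩ := ht.2.1 _ hD
      exact ⟨e', Finset.mem_union_right _ h1, h2⟩
    · obtain ⟨e', h1, h2⟩ := hT.ex e he hez
      exact ⟨e', Finset.mem_union_left _ (Finset.mem_filter.2 ⟨h1, h2 ▸ hD⟩), h2⟩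
  · intro e he e' he' hee
    rcases Finset.mem_union.1 he with h | h <;> rcases Finset.mem_union.1 he' with h' | h'
    · exact hT.uniq e (Finset.mem_filter.1 h).1 e' (Finset.mem_filter.1 h').1 hee
    · exact absurd (hee ▸ htS e' h') (Finset.mem_filter.1 h).2
    · exact absurd (hee ▸ htS e h) (Finset.mem_filter.1 h').2
    · exact (ht.2.1 _ (htS e h)).unique ⟨h, rfl⟩ ⟨h', hee.symm⟩
  · intro e he
    have hmono : ∀ a b, G.step (t : Set E) a b → G.step (swp G (DS G S T) T t : Set E) a b := by
      rintro a b ⟨e, he, h⟩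
      exact ⟨e, Finset.mem_coe.2 (Finset.mem_union_right _ he), h⟩
    by_cases hD : G.dst e ∈ DS G S T
    · obtain ⟨v', h1, h2⟩ := ht.2.2 _ hD
      refine (Relation.ReflTransGen.mono hmono _ _ h2).trans ?_
      rcases h2.cases_tail with h | ⟨c, _, e', he', _, h3⟩
      · exact absurd hD (h ▸ h1)
      · subst h3
        exact stay G S T t _ _ (hT.flow e' (htR e' he')) h1
    · exact stay G S T t _ _ (hT.flow e he) hD

lemma swp_DS (T t : Finset E) (ht : IsWiredArb G (DS G S T : Set V) (t : Set E)) :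
    DS G S (swp G (DS G S T) T t) = DS G S T := by
  ext v
  constructor
  · intro hv
    by_contra hvD
    obtain ⟨h1, h2⟩ := Finset.mem_filter.1 hv
    refine hvD (Finset.mem_filter.2 ⟨h1, fun u hu => ?_⟩)
    by_cases huD : u ∈ DS G S T
    · exact DS_sub G S T huD
    · exact h2 u (stay G S T t _ _ hu huD)
  · intro hv
    have : ∀ u, Relation.ReflTransGen (G.step (swp G (DS G S T) T t : Set E)) u v →
        u ∈ DS G S T := by
      intro u hu
      induction hu using Relation.ReflTransGen.head_induction_on with
      | refl => exact hv
      | head h _ ih =>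
        obtain ⟨e, he, rfl, rfl⟩ := h
        rcases Finset.mem_union.1 he with h | h
        · exact DS_past G S T e (Finset.mem_filter.1 h).1 ih
        · exact ht.1 e h
    exact Finset.mem_filter.2 ⟨DS_sub G S T hv, fun u hu => DS_sub G S T (this u hu)⟩

noncomputable def TT (D : Finset V) : Finset (Finset E) :=
  R.powerset.filter (fun T => Arb G R z T ∧ DS G S T = D)

noncomputable def WW (D : Finset V) : Finset (Finset E) :=
  R.powerset.filter (fun t => IsWiredArb G (D : Set V) (t : Set E))

lemma swap_maps (hV : Vld G R z S) (D : Finset V) (T t : Finset E) (hT : T ∈ TT G R z S D) (ht : t ∈ WW G R D) :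
    swp G D T t ∈ TT G R z S D ∧ rst G D T ∈ WW G R D ∧
      swp G D (swp G D T t) (rst G D T) = T ∧ rst G D (swp G D T t) = t := by
  obtain ⟨h1, h2, rfl⟩ := Finset.mem_filter.1 hT
  obtain ⟨h3, h4⟩ := Finset.mem_filter.1 ht
  have h5 := swp_arb G R z S hV T t h2 h4
  have htS : ∀ e ∈ t, G.src e ∈ DS G S T := fun e he => h4.1 e he
  refine ⟨?_, ?_, ?_, ?_⟩
  · exact Finset.mem_filter.2 ⟨Finset.mem_powerset.2 h5.sub, h5, swp_DS G S T t h4⟩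
  · refine Finset.mem_filter.2 ⟨Finset.mem_powerset.2 ?_, rst_wired G R z S hV T h2⟩
    exact (Finset.filter_subset _ _).trans h2.sub
  · ext e
    have := htS e
    simp only [swp, rst, Finset.mem_union, Finset.mem_filter]
    tauto
  · ext e
    have := htS e
    simp only [swp, rst, Finset.mem_union, Finset.mem_filter]
    tauto

lemma swap_card (hV : Vld G R z S) (D : Finset V) (F : Finset E) (hF : ∀ e ∈ F, G.src e ∈ D) :
    ((TT G R z S D).filter (F ⊆ ·)).card * (WW G R D).card =
      (TT G R z S D).card * ((WW G R D).filter (F ⊆ ·)).card := by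
  rw [← Finset.card_product, ← Finset.card_product]
  have key := swap_maps G R z S hV D
  refine Finset.card_nbij' (fun p => (swp G D p.1 p.2, rst G D p.1))
    (fun p => (swp G D p.1 p.2, rst G D p.1)) ?_ ?_ ?_ ?_
  · rintro ⟨T, t⟩ h
    simp only [Finset.coe_product, Set.mem_prod, Finset.mem_coe, Finset.mem_filter] at h ⊢
    obtain ⟨⟨h1, h2⟩, h3⟩ := h
    obtain ⟨k1, k2, k3, k4⟩ := key T t h1 h3
    exact ⟨k1, k2, fun e he => Finset.mem_filter.2 ⟨h2 he, hF e he⟩⟩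
  · rintro ⟨T, t⟩ h
    simp only [Finset.coe_product, Set.mem_prod, Finset.mem_coe, Finset.mem_filter] at h ⊢
    obtain ⟨h1, h3, h2⟩ := h
    obtain ⟨k1, k2, k3, k4⟩ := key T t h1 h3
    exact ⟨⟨k1, fun e he => Finset.mem_union_right _ (h2 he)⟩, k2⟩
  · rintro ⟨T, t⟩ h
    simp only [Finset.coe_product, Set.mem_prod, Finset.mem_coe, Finset.mem_filter] at h ⊢
    obtain ⟨⟨h1, h2⟩, h3⟩ := h
    obtain ⟨k1, k2, k3, k4⟩ := key T t h1 h3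
    exact Prod.ext k3 k4
  · rintro ⟨T, t⟩ h
    simp only [Finset.coe_product, Set.mem_prod, Finset.mem_coe, Finset.mem_filter] at h ⊢
    obtain ⟨h1, h3, h2⟩ := h
    obtain ⟨k1, k2, k3, k4⟩ := key T t h1 h3
    exact Prod.ext k3 k4

lemma natcard_wired (D : Finset V) (hD : ∀ e, G.src e ∈ D → e ∈ R) (F : Finset E) :
    Nat.card {B : Set E // IsWiredArb G (D : Set V) B ∧ (F : Set E) ⊆ B} =
      ((WW G R D).filter (F ⊆ ·)).card := by
  rw [← Finset.card_image_of_injective _ (Finset.coe_injective (α := E))]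
  apply Nat.subtype_card
  intro B
  simp only [Finset.mem_image, Finset.mem_filter, WW, Finset.mem_powerset]
  constructor
  · rintro ⟨t, ⟨⟨h1, h2⟩, h3⟩, rfl⟩
    exact ⟨h2, Finset.coe_subset.2 h3⟩
  · rintro ⟨h1, h2⟩
    have hB : B ⊆ (R : Set E) := fun e he => hD e (h1.1 e he)
    have hf : B.Finite := R.finite_toSet.subset hB
    refine ⟨hf.toFinset, ⟨⟨?_, ?_⟩, ?_⟩, hf.coe_toFinset⟩
    · intro e he; exact hB (hf.mem_toFinset.1 he)
    · rw [hf.coe_toFinset]; exact h1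
    · intro e he; exact hf.mem_toFinset.2 (h2 he)

lemma wired_eq (D : Finset V) (hD : ∀ e, G.src e ∈ D → e ∈ R) (F : Finset E) :
    wiredUACyl G (D : Set V) F =
      (((WW G R D).filter (F ⊆ ·)).card : ℝ≥0∞) / ((WW G R D).card : ℝ≥0∞) := by
  have h0 := natcard_wired G R D hD ∅
  simp only [Finset.coe_empty, Set.empty_subset, and_true, Finset.empty_subset,
    Finset.filter_true] at h0
  rw [wiredUACyl, natcard_wired G R D hD F, h0]

lemma TT_ratio (hV : Vld G R z S) (D : Finset V) (hDS : D ⊆ S) (F : Finset E)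
    (hF : ∀ e ∈ F, G.src e ∈ D) :
    (((TT G R z S D).filter (F ⊆ ·)).card : ℝ≥0∞) =
      (TT G R z S D).card * wiredUACyl G (D : Set V) F := by
  rcases (TT G R z S D).eq_empty_or_nonempty with h | ⟨T, hT⟩
  · simp [h]
  rw [wired_eq G R D (fun e he => hV.hSR e (hDS he)) F]
  have h1 := swap_card G R z S hV D F hF
  have hW : (WW G R D).card ≠ 0 := by
    rw [Finset.card_ne_zero]
    obtain ⟨h1, h2, rfl⟩ := Finset.mem_filter.1 hT
    refine ⟨rst G (DS G S T) T, Finset.mem_filter.2 ⟨Finset.mem_powerset.2 ?_,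
      rst_wired G R z S hV T h2⟩⟩
    exact (Finset.filter_subset _ _).trans h2.sub
  rw [← mul_div_assoc]
  rw [ENNReal.eq_div_iff (by exact_mod_cast hW) (ENNReal.natCast_ne_top _)]
  rw [mul_comm]
  exact_mod_cast h1

noncomputable def AA (D0 : Finset V) : Finset (Finset E) :=
  R.powerset.filter (fun T => Arb G R z T ∧ D0 ⊆ DS G S T)

lemma AA_sum (D0 : Finset V) (F : Finset E) : ((AA G R z S D0).filter (F ⊆ ·)).card =
    ∑ D ∈ S.powerset.filter (D0 ⊆ ·), ((TT G R z S D).filter (F ⊆ ·)).card := by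
  rw [Finset.card_eq_sum_card_fiberwise (f := DS G S) (t := S.powerset.filter (D0 ⊆ ·))]
  · apply Finset.sum_congr rfl
    intro D hD
    congr 1
    ext T
    have := (Finset.mem_filter.1 hD).2
    simp only [AA, TT, Finset.mem_filter]
    constructor
    · tauto
    · rintro ⟨⟨h1, h2, rfl⟩, h3⟩
      tauto
  · intro T hT
    simp only [AA, Finset.mem_filter, Finset.mem_coe] at hT
    simp only [Finset.mem_filter, Finset.mem_coe, Finset.mem_powerset]
    exact ⟨DS_sub G S T, hT.1.2.2⟩

lemma AA_sum0 (D0 : Finset V) : (AA G R z S D0).card =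
    ∑ D ∈ S.powerset.filter (D0 ⊆ ·), (TT G R z S D).card := by
  have := AA_sum G R z S D0 ∅
  simpa only [Finset.empty_subset, Finset.filter_true] using this

lemma AA_upper (hV : Vld G R z S) (D0 : Finset V) (F : Finset E)
    (hF : ∀ e ∈ F, G.src e ∈ D0) (U : ℝ≥0∞)
    (hU : ∀ D : Finset V, D0 ⊆ D → wiredUACyl G (D : Set V) F ≤ U) :
    (((AA G R z S D0).filter (F ⊆ ·)).card : ℝ≥0∞) ≤ (AA G R z S D0).card * U := by
  rw [AA_sum, AA_sum0]
  push_cast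
  rw [Finset.sum_mul]
  apply Finset.sum_le_sum
  intro D hD
  obtain ⟨h1, h2⟩ := Finset.mem_filter.1 hD
  rw [TT_ratio G R z S hV D (Finset.mem_powerset.1 h1) F (fun e he => h2 (hF e he))]
  gcongr
  exact hU D h2

lemma AA_lower (hV : Vld G R z S) (D0 : Finset V) (F : Finset E)
    (hF : ∀ e ∈ F, G.src e ∈ D0) (U : ℝ≥0∞)
    (hU : ∀ D : Finset V, D0 ⊆ D → U ≤ wiredUACyl G (D : Set V) F) :
    (AA G R z S D0).card * U ≤ (((AA G R z S D0).filter (F ⊆ ·)).card : ℝ≥0∞) := by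
  rw [AA_sum, AA_sum0]
  push_cast
  rw [Finset.sum_mul]
  apply Finset.sum_le_sum
  intro D hD
  obtain ⟨h1, h2⟩ := Finset.mem_filter.1 hD
  rw [TT_ratio G R z S hV D (Finset.mem_powerset.1 h1) F (fun e he => h2 (hF e he))]
  gcongr
  exact hU D h2

end EXPL

section PATHS
open Classical

variable {V E : Type} (G : DigraphStruct V E)

lemma LE_mono_cons (z : V) (e : E) (P : List E) : LE G z P ⊆ LE G z (e :: P) := by
  rw [LE]
  split_ifs
  · exact subset_rfl
  · exact Finset.subset_insert _ _

lemma LE_nz (z : V) (P : List E) : ∀ e ∈ LE G z P, G.src e ≠ z := by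
  induction P with
  | nil => simp [LE]
  | cons a P ih =>
    intro e he
    rw [LE] at he
    split_ifs at he with h
    · exact ih e he
    · rcases Finset.mem_insert.1 he with rfl | he
      · exact fun h' => h (Or.inl h')
      · exact ih e he

lemma LE_ex (z : V) (P : List E) : ∀ e ∈ P, G.src e ≠ z → ∃ e' ∈ LE G z P, G.src e' = G.src e := by
  induction P with
  | nil => simp
  | cons a P ih =>
    intro e he hz
    have hP : ∀ e ∈ P, G.src e ≠ z → ∃ e' ∈ LE G z (a :: P), G.src e' = G.src e := by
      intro e he hz
      obtain ⟨e', h1, h2⟩ := ih e he hz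
      exact ⟨e', LE_mono_cons G z a P h1, h2⟩
    rcases List.mem_cons.1 he with rfl | he
    · by_cases h : G.src e ∈ P.map G.src
      · obtain ⟨b, hb, hbe⟩ := List.mem_map.1 h
        obtain ⟨e', h1, h2⟩ := hP b hb (hbe ▸ hz)
        exact ⟨e', h1, h2.trans hbe⟩
      · refine ⟨e, ?_, rfl⟩
        rw [LE, if_neg (by tauto)]
        exact Finset.mem_insert_self _ _
    · exact hP e he hz

lemma LE_uniq (z : V) (P : List E) : ∀ e ∈ LE G z P, ∀ e' ∈ LE G z P, G.src e = G.src e' →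
    e = e' := by
  induction P with
  | nil => simp [LE]
  | cons a P ih =>
    rw [LE]
    split_ifs with h
    · exact ih
    · have hn : ∀ e ∈ LE G z P, G.src e ≠ G.src a := by
        intro e he h'
        exact h (Or.inr (List.mem_map.2 ⟨e, LE_sub G z P e he, h'⟩))
      intro e he e' he' hee
      rcases Finset.mem_insert.1 he with h1 | h1 <;>
        rcases Finset.mem_insert.1 he' with h2 | h2
      · exact h1.trans h2.symm
      · exact absurd (hee.symm.trans (congrArg G.src h1)) (hn _ h2)
      · exact absurd (hee.trans (congrArg G.src h2)) (hn _ h1)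
      · exact ih e h1 e' h2 hee

lemma LE_flow (z : V) (P : List E) : ∀ o, IsPathList G o z P → ∀ e ∈ P,
    Relation.ReflTransGen (G.step (LE G z P : Set E)) (G.dst e) z := by
  induction P with
  | nil => simp
  | cons a P ih =>
    intro o hP
    have hmono : ∀ x y, G.step (LE G z P : Set E) x y → G.step (LE G z (a :: P) : Set E) x y := by
      rintro x y ⟨e, he, h⟩
      exact ⟨e, LE_mono_cons G z a P he, h⟩
    have hP' : ∀ e ∈ P, Relation.ReflTransGen (G.step (LE G z (a :: P) : Set E)) (G.dst e) z :=
      fun e he => Relation.ReflTransGen.mono hmono _ _ (ih _ hP.2 e he)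
    intro e he
    rcases List.mem_cons.1 he with rfl | he
    · cases P with
      | nil =>
        have : G.dst e = z := hP.2
        rw [this]
      | cons b P =>
        have hb : G.src b = G.dst e := hP.2.1
        by_cases hz : G.src b = z
        · rw [← hb, hz]
        · obtain ⟨e', h1, h2⟩ := LE_ex G z (b :: P) b (by simp) hz
          refine .head ⟨e', LE_mono_cons G z e _ h1, h2.trans hb, rfl⟩
            (hP' e' (LE_sub G z _ e' h1))
    · exact hP' e he

lemma LE_arb (o z : V) (P : List E) (hP : IsPathList G o z P) :
    Arb G P.toFinset z (LE G z P) where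
  sub := fun e he => List.mem_toFinset.2 (LE_sub G z P e he)
  nz := LE_nz G z P
  ex := fun e he => LE_ex G z P e (List.mem_toFinset.1 he)
  uniq := LE_uniq G z P
  flow := fun e he => LE_flow G z P o hP e (List.mem_toFinset.1 he)

lemma path_bal (z : V) (P : List E) : ∀ o, IsPathList G o z P → P.Nodup →
    Bal G P.toFinset o z := by
  induction P with
  | nil =>
    intro o h _
    have : o = z := h
    subst this
    intro v
    simp [dI, dO]
  | cons a P ih =>
    intro o h hn
    obtain ⟨rfl, h2⟩ := h
    rw [List.nodup_cons] at hn
    rw [Bal_erase G _ z a (by simp)]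
    have : (a :: P).toFinset.erase a = P.toFinset := by
      rw [List.toFinset_cons, Finset.erase_insert]
      simpa using hn.1
    rw [this]
    exact ih _ h2 hn.2

/-- The list of the first `n` edges of `γ`. -/
def pre (n : ℕ) (γ : ℕ → E) : List E := List.ofFn (fun i : Fin n => γ i)

lemma pre_succ (n : ℕ) (γ : ℕ → E) : pre (n + 1) γ = γ 0 :: pre n (fun i => γ (i + 1)) := by
  rw [pre, List.ofFn_succ]
  rfl

lemma mem_pre (n : ℕ) (γ : ℕ → E) (e : E) : e ∈ pre n γ ↔ ∃ k < n, γ k = e := by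
  rw [pre, List.mem_ofFn']
  constructor
  · rintro ⟨k, rfl⟩
    exact ⟨k, k.2, rfl⟩
  · rintro ⟨k, hk, rfl⟩
    exact ⟨⟨k, hk⟩, rfl⟩

lemma pre_path (n : ℕ) : ∀ (γ : ℕ → E), (∀ i, G.dst (γ i) = G.src (γ (i + 1))) →
    IsPathList G (G.src (γ 0)) (G.src (γ n)) (pre n γ) := by
  induction n with
  | zero => intro γ _; exact rfl
  | succ n ih =>
    intro γ h
    rw [pre_succ]
    refine ⟨rfl, ?_⟩
    rw [h 0]
    exact ih (fun i => γ (i + 1)) (fun i => h (i + 1))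

lemma mem_LE_pre (z : V) (n : ℕ) : ∀ (γ : ℕ → E) (e : E), e ∈ LE G z (pre n γ) ↔
    ∃ k < n, γ k = e ∧ G.src e ≠ z ∧ ∀ j, k < j → j < n → G.src (γ j) ≠ G.src e := by
  induction n with
  | zero => intro γ e; simp [pre, LE]
  | succ n ih =>
    intro γ e
    rw [pre_succ, LE]
    have hm : G.src (γ 0) ∈ (pre n (fun i => γ (i + 1))).map G.src ↔
        ∃ j < n, G.src (γ (j + 1)) = G.src (γ 0) := by
      rw [List.mem_map]
      constructor
      · rintro ⟨a, ha, h⟩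
        obtain ⟨k, hk, rfl⟩ := (mem_pre _ _ _).1 ha
        exact ⟨k, hk, h⟩
      · rintro ⟨k, hk, h⟩
        exact ⟨_, (mem_pre _ _ _).2 ⟨k, hk, rfl⟩, h⟩
    have hshift : (∃ k < n, γ (k + 1) = e ∧ G.src e ≠ z ∧
          ∀ j, k < j → j < n → G.src (γ (j + 1)) ≠ G.src e) ↔
        ∃ k < n + 1, 0 < k ∧ γ k = e ∧ G.src e ≠ z ∧
          ∀ j, k < j → j < n + 1 → G.src (γ j) ≠ G.src e := by
      constructor
      · rintro ⟨k, h1, h2, h3, h4⟩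
        refine ⟨k + 1, by omega, by omega, h2, h3, ?_⟩
        intro j hj hj'
        obtain ⟨j, rfl⟩ : ∃ j', j = j' + 1 := ⟨j - 1, by omega⟩
        exact h4 j (by omega) (by omega)
      · rintro ⟨k, h1, h0, h2, h3, h4⟩
        obtain ⟨k, rfl⟩ : ∃ j', k = j' + 1 := ⟨k - 1, by omega⟩
        exact ⟨k, by omega, h2, h3, fun j hj hj' => h4 (j + 1) (by omega) (by omega)⟩
    have ih' := ih (fun i => γ (i + 1)) e
    rw [hshift] at ih'
    split_ifs with h
    · rw [ih']
      constructor
      · rintro ⟨k, h1, h0, h2⟩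
        exact ⟨k, h1, h2⟩
      · rintro ⟨k, h1, h2, h3, h4⟩
        refine ⟨k, h1, ?_, h2, h3, h4⟩
        rcases Nat.eq_zero_or_pos k with rfl | hk
        · exfalso
          subst h2
          rcases h with h | h
          · exact h3 h
          · obtain ⟨j, hj, hj'⟩ := hm.1 h
            exact h4 (j + 1) (by omega) (by omega) hj'
        · exact hk
    · rw [Finset.mem_insert, ih']
      constructor
      · rintro (rfl | ⟨k, h1, h0, h2⟩)
        · refine ⟨0, by omega, rfl, fun h' => h (Or.inl h'), fun j hj hj' h' => h (Or.inr ?_)⟩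
          obtain ⟨j, rfl⟩ : ∃ j', j = j' + 1 := ⟨j - 1, by omega⟩
          exact hm.2 ⟨j, by omega, h'⟩
        · exact ⟨k, h1, h2⟩
      · rintro ⟨k, h1, h2⟩
        rcases Nat.eq_zero_or_pos k with rfl | hk
        · exact Or.inl h2.1.symm
        · exact Or.inr ⟨k, h1, hk, h2⟩

lemma initPath_of_list (n : ℕ) : ∀ (o z : V) (w : Fin n → E), IsPathList G o z (List.ofFn w) →
    PrefixPath G o w := by
  induction n with
  | zero =>
    intro o z w _
    exact ⟨fun h => absurd h (by omega), fun i h => absurd h (by omega)⟩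
  | succ n ih =>
    intro o z w h
    rw [List.ofFn_succ] at h
    obtain ⟨h1, h2⟩ := h
    have h3 := ih _ _ _ h2
    refine ⟨fun _ => h1, ?_⟩
    intro i hi
    cases i with
    | zero => exact (h3.1 (by omega)).symm
    | succ i => exact h3.2 i (by omega)

end PATHS

section MEAS
open Classical

variable {V E : Type} [Countable V] [Countable E] [MeasurableSpace E]
    [DiscreteMeasurableSpace E] (G : DigraphStruct V E) (o : V)

lemma meas_coord (i : ℕ) (Q : E → Prop) : MeasurableSet {γ : ℕ → E | Q (γ i)} :=
  measurable_pi_apply i (MeasurableSet.of_discrete (s := {e | Q e}))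

lemma meas_pre (n : ℕ) (Q : List E → Prop) : MeasurableSet {γ : ℕ → E | Q (pre n γ)} := by
  have hm : Measurable (fun (γ : ℕ → E) (i : Fin n) => γ i) :=
    measurable_pi_lambda _ (fun i => measurable_pi_apply _)
  exact hm (MeasurableSet.of_discrete (s := {w : Fin n → E | Q (List.ofFn w)}))

/-- Sequences starting at `z` whose set of unvisited vertices is `S`. -/
def BS (z : V) (S : Finset V) : Set (ℕ → E) :=
  {τ | G.src (τ 0) = z ∧ ∀ v, v ∈ S ↔ ∀ i, G.src (τ i) ≠ v}

lemma meas_tailB (n : ℕ) (z : V) (S : Finset V) :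
    MeasurableSet {γ : ℕ → E | (fun t => γ (n + t)) ∈ BS G z S} := by
  have : {γ : ℕ → E | (fun t => γ (n + t)) ∈ BS G z S} =
      {γ : ℕ → E | G.src (γ (n + 0)) = z} ∩
        ⋂ v : V, {γ : ℕ → E | v ∈ S ↔ ∀ i, G.src (γ (n + i)) ≠ v} := by
    ext γ
    simp [BS]
  rw [this]
  refine (meas_coord _ (fun e => G.src e = z)).inter (MeasurableSet.iInter fun v => ?_)
  have hm : MeasurableSet {γ : ℕ → E | ∀ i, G.src (γ (n + i)) ≠ v} := by
    rw [Set.setOf_forall]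
    exact MeasurableSet.iInter fun i => meas_coord _ (fun e => G.src e ≠ v)
  by_cases hv : v ∈ S
  · simpa [hv] using hm
  · have : {γ : ℕ → E | v ∈ S ↔ ∀ i, G.src (γ (n + i)) ≠ v} =
        {γ : ℕ → E | ∀ i, G.src (γ (n + i)) ≠ v}ᶜ := by
      ext γ
      simp [hv]
    rw [this]
    exact hm.compl

abbrev Idx (V E : Type) := Finset E × V × Finset V

noncomputable def PL (D0 : Finset V) (i : Idx V E) (F : Finset E) : Finset (List E) :=
  if Vld G i.1 i.2.1 i.2.2 ∧ Bal G i.1 o i.2.1 then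
    ((AA G i.1 i.2.1 i.2.2 D0).filter (F ⊆ ·)).biUnion (eul G i.1 o i.2.1)
  else ∅

lemma mem_PL (D0 : Finset V) (i : Idx V E) (F : Finset E) (P : List E) :
    P ∈ PL G o D0 i F ↔ Vld G i.1 i.2.1 i.2.2 ∧ Bal G i.1 o i.2.1 ∧
      Arb G i.1 i.2.1 (LE G i.2.1 P) ∧ D0 ⊆ DS G i.2.2 (LE G i.2.1 P) ∧ F ⊆ LE G i.2.1 P ∧
      i.1.val = (P : Multiset E) ∧ IsPathList G o i.2.1 P := by
  unfold PL
  split_ifs with h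
  · simp only [Finset.mem_biUnion, Finset.mem_filter, AA, mem_eul, Finset.mem_powerset]
    constructor
    · rintro ⟨T, ⟨⟨h1, h2, h3⟩, h4⟩, h5, h6, rfl⟩
      exact ⟨h.1, h.2, h2, h3, h4, h5, h6⟩
    · rintro ⟨_, _, h2, h3, h4, h5, h6⟩
      exact ⟨_, ⟨⟨h2.sub, h2, h3⟩, h4⟩, h5, h6, rfl⟩
  · simp only [Finset.notMem_empty, false_iff]
    tauto

lemma card_PL (D0 : Finset V) (i : Idx V E) (h : Vld G i.1 i.2.1 i.2.2 ∧ Bal G i.1 o i.2.1)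
    (F : Finset E) : (PL G o D0 i F).card =
      ((AA G i.1 i.2.1 i.2.2 D0).filter (F ⊆ ·)).card * cst G i.1 i.2.1 (i.1.image G.src) := by
  rw [PL, if_pos h, Finset.card_biUnion, Finset.sum_const_nat]
  · intro T hT
    refine best G _ _ _ _ _ h.2 ?_ subset_rfl
    exact (Finset.mem_filter.1 (Finset.mem_filter.1 hT).1).2.1
  · intro T _ T' _ hTT
    rw [Function.onFun, Finset.disjoint_left]
    intro P h1 h2
    exact hTT (((mem_eul _ _ _ _ _ _).1 h1).2.2.symm.trans ((mem_eul _ _ _ _ _ _).1 h2).2.2)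

lemma PL_mono (D0 : Finset V) (i : Idx V E) (F : Finset E) : PL G o D0 i F ⊆ PL G o D0 i ∅ := by
  intro P hP
  rw [mem_PL] at hP ⊢
  obtain ⟨h1, h2, h3, h4, h5, h6⟩ := hP
  exact ⟨h1, h2, h3, h4, by simp, h6⟩

def cyl (n : ℕ) (i : Idx V E) (P : List E) : Set (ℕ → E) :=
  {γ | pre n γ = P ∧ (fun t => γ (n + t)) ∈ BS G i.2.1 i.2.2}

lemma meas_cyl (n : ℕ) (i : Idx V E) (P : List E) : MeasurableSet (cyl G n i P) :=
  (meas_pre n (fun Q => Q = P)).inter (meas_tailB G n _ _)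

variable (μ : Measure (ℕ → E)) (hμ : ProperGibbs G o μ)

lemma cyl_const (hμ : ProperGibbs G o μ) (D0 : Finset V) (n : ℕ) (i : Idx V E) :
    ∃ m : ℝ≥0∞, ∀ P ∈ PL G o D0 i ∅, μ (cyl G n i P) = m := by
  rcases (PL G o D0 i ∅).eq_empty_or_nonempty with h | ⟨P0, hP0⟩
  · rw [h]; exact ⟨0, by simp⟩
  refine ⟨μ (cyl G n i P0), fun P hP => ?_⟩
  have hl : ∀ P ∈ PL G o D0 i ∅, P.length = i.1.card := by
    intro P hP
    rw [mem_PL] at hP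
    have := congrArg Multiset.card hP.2.2.2.2.2.1
    simpa using this.symm
  by_cases hn : i.1.card = n
  · have hw : ∀ P ∈ PL G o D0 i ∅, ∃ w : Fin n → E, List.ofFn w = P := by
      intro P hP
      have := (hl P hP).trans hn
      subst this
      exact ⟨P.get, List.ofFn_get P⟩
    obtain ⟨w, rfl⟩ := hw P hP
    obtain ⟨w0, rfl⟩ := hw P0 hP0
    rw [mem_PL] at hP hP0
    have hinj : ∀ w : Fin n → E, i.1.val = (List.ofFn w : Multiset E) → Function.Injective w := by
      intro w h
      rw [← List.nodup_ofFn, ← Multiset.coe_nodup, ← h]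
      exact i.1.nodup
    have hran : ∀ w : Fin n → E, i.1.val = (List.ofFn w : Multiset E) →
        Set.range w = (i.1 : Set E) := by
      intro w h
      ext e
      rw [Finset.mem_coe, ← Finset.mem_val, h, Multiset.mem_coe, List.mem_ofFn']
    have hc : ∀ w : Fin n → E, cyl G n i (List.ofFn w) =
        {γ | (∀ k : Fin n, γ (k : ℕ) = w k) ∧ (fun t : ℕ => γ (n + t)) ∈ BS G i.2.1 i.2.2} := by
      intro w
      ext γ
      simp only [cyl, pre, Set.mem_setOf_eq, List.ofFn_inj, funext_iff]
    rw [hc, hc]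
    have h1 := hP.2.2.2.2.2.1
    have h2 := hP0.2.2.2.2.2.1
    exact hμ.2.2 n w w0 (hinj w h1) (hinj w0 h2) ((hran w h1).trans (hran w0 h2).symm)
      (initPath_of_list G n _ _ w hP.2.2.2.2.2.2) (initPath_of_list G n _ _ w0 hP0.2.2.2.2.2.2) _
  · have : ∀ P ∈ PL G o D0 i ∅, cyl G n i P = ∅ := by
      intro P hP
      rw [Set.eq_empty_iff_forall_notMem]
      rintro γ ⟨rfl, -⟩
      have := hl _ hP
      rw [pre, List.length_ofFn] at this
      exact hn this.symm
    rw [this P hP, this P0 hP0]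

def XX (D0 : Finset V) (n : ℕ) (F : Finset E) (i : Idx V E) : Set (ℕ → E) :=
  {γ | pre n γ ∈ PL G o D0 i F ∧ (fun t => γ (n + t)) ∈ BS G i.2.1 i.2.2}

lemma meas_XX (D0 : Finset V) (n : ℕ) (F : Finset E) (i : Idx V E) :
    MeasurableSet (XX G o D0 n F i) :=
  (meas_pre n (fun Q => Q ∈ PL G o D0 i F)).inter (meas_tailB G n _ _)

lemma XX_meas (hμ : ProperGibbs G o μ) (D0 : Finset V) (n : ℕ) (i : Idx V E) :
    ∃ m : ℝ≥0∞, ∀ F, μ (XX G o D0 n F i) = (PL G o D0 i F).card * m := by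
  obtain ⟨m, hm⟩ := cyl_const G o μ hμ D0 n i
  refine ⟨m, fun F => ?_⟩
  have : XX G o D0 n F i = ⋃ P ∈ PL G o D0 i F, cyl G n i P := by
    ext γ
    simp only [XX, cyl, Set.mem_setOf_eq, Set.mem_iUnion, exists_prop]
    constructor
    · rintro ⟨h1, h2⟩; exact ⟨_, h1, rfl, h2⟩
    · rintro ⟨P, h1, rfl, h2⟩; exact ⟨h1, h2⟩
  rw [this, measure_biUnion_finset]
  · rw [Finset.sum_congr rfl (fun P hP => hm P (PL_mono G o D0 i F hP))]
    simp
  · intro P _ P' _ hPP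
    rw [Function.onFun, Set.disjoint_left]
    rintro γ ⟨h1, _⟩ ⟨h2, _⟩
    exact hPP (h1.symm.trans h2)
  · intro P _
    exact meas_cyl G n i P

def EE (D0 : Finset V) (n : ℕ) (F : Finset E) : Set (ℕ → E) := ⋃ i, XX G o D0 n F i

lemma EE_meas (D0 : Finset V) (n : ℕ) (F : Finset E) :
    μ (EE G o D0 n F) = ∑' i, μ (XX G o D0 n F i) := by
  apply measure_iUnion
  · intro i j hij
    rw [Function.onFun, Set.disjoint_left]
    rintro γ ⟨h1, h2⟩ ⟨h3, h4⟩
    apply hij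
    rw [mem_PL] at h1 h3
    refine Prod.ext ?_ (Prod.ext ?_ ?_)
    · exact Finset.val_injective (h1.2.2.2.2.2.1.trans h3.2.2.2.2.2.1.symm)
    · exact h2.1.symm.trans h4.1
    · ext v
      rw [h2.2 v, h4.2 v]
  · exact meas_XX G o D0 n F

lemma EE_upper (hμ : ProperGibbs G o μ) (D0 : Finset V) (n : ℕ) (F : Finset E)
    (hF : ∀ e ∈ F, G.src e ∈ D0) (U : ℝ≥0∞)
    (hU : ∀ D : Finset V, D0 ⊆ D → wiredUACyl G (D : Set V) F ≤ U) :
    μ (EE G o D0 n F) ≤ μ (EE G o D0 n ∅) * U := by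
  rw [EE_meas, EE_meas, ← ENNReal.tsum_mul_right]
  refine ENNReal.tsum_le_tsum fun i => ?_
  obtain ⟨m, hm⟩ := XX_meas G o μ hμ D0 n i
  rw [hm, hm]
  by_cases h : Vld G i.1 i.2.1 i.2.2 ∧ Bal G i.1 o i.2.1
  · rw [card_PL G o D0 i h, card_PL G o D0 i h]
    have := AA_upper G _ _ _ h.1 D0 F hF U hU
    simp only [Finset.empty_subset, Finset.filter_true]
    push_cast
    calc _ ≤ ((AA G i.1 i.2.1 i.2.2 D0).card * U) * (cst G i.1 i.2.1 (i.1.image G.src) : ℝ≥0∞) * m := by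
            gcongr
      _ = _ := by ring
  · simp [PL, h]

lemma EE_lower (hμ : ProperGibbs G o μ) (D0 : Finset V) (n : ℕ) (F : Finset E)
    (hF : ∀ e ∈ F, G.src e ∈ D0) (U : ℝ≥0∞)
    (hU : ∀ D : Finset V, D0 ⊆ D → U ≤ wiredUACyl G (D : Set V) F) :
    μ (EE G o D0 n ∅) * U ≤ μ (EE G o D0 n F) := by
  rw [EE_meas, EE_meas, ← ENNReal.tsum_mul_right]
  refine ENNReal.tsum_le_tsum fun i => ?_
  obtain ⟨m, hm⟩ := XX_meas G o μ hμ D0 n i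
  rw [hm, hm]
  by_cases h : Vld G i.1 i.2.1 i.2.2 ∧ Bal G i.1 o i.2.1
  · rw [card_PL G o D0 i h, card_PL G o D0 i h]
    have := AA_lower G _ _ _ h.1 D0 F hF U hU
    simp only [Finset.empty_subset, Finset.filter_true]
    push_cast
    calc _ = ((AA G i.1 i.2.1 i.2.2 D0).card * U) * (cst G i.1 i.2.1 (i.1.image G.src) : ℝ≥0∞) * m := by
            ring
      _ ≤ _ := by gcongr
  · simp [PL, h]

def LX (F : Finset E) : Set (ℕ → E) := {γ | ∀ e ∈ F, e ∈ G.lastExitSet γ}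

lemma EE_sub (D0 : Finset V) (n : ℕ) (F : Finset E) (hF : ∀ e ∈ F, G.src e ∈ D0) :
    EE G o D0 n F ⊆ LX G F := by
  intro γ hγ e he
  obtain ⟨i, h1, h2⟩ := Set.mem_iUnion.1 hγ
  rw [mem_PL] at h1
  obtain ⟨k, hk, rfl, _, h3⟩ := (mem_LE_pre G _ n γ e).1 (h1.2.2.2.2.1 he)
  refine ⟨k, rfl, fun j hj => ?_⟩
  by_cases hjn : j < n
  · exact h3 j hj hjn
  · have h4 := DS_sub _ _ _ (h1.2.2.2.1 (hF _ he))
    have := (h2.2 _).1 h4 (j - n)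
    change G.src (γ (n + (j - n))) ≠ _ at this
    rwa [Nat.add_sub_cancel' (not_lt.1 hjn)] at this

lemma EE_sup (D0 : Finset V) (n : ℕ) (F : Finset E) (hF : ∀ e ∈ F, G.src e ∈ D0) :
    LX G F ∩ EE G o D0 n ∅ ⊆ EE G o D0 n F := by
  rintro γ ⟨hL, hγ⟩
  obtain ⟨i, h1, h2⟩ := Set.mem_iUnion.1 hγ
  refine Set.mem_iUnion.2 ⟨i, ?_, h2⟩
  rw [mem_PL] at h1 ⊢
  refine ⟨h1.1, h1.2.1, h1.2.2.1, h1.2.2.2.1, ?_, h1.2.2.2.2.2⟩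
  intro e he
  obtain ⟨k, rfl, hk⟩ := hL e he
  have h4 := DS_sub _ _ _ (h1.2.2.2.1 (hF _ he))
  have h5 := (h2.2 _).1 h4
  have hkn : k < n := by
    by_contra hkn
    have := h5 (k - n)
    simp only [Nat.add_sub_cancel' (not_lt.1 hkn)] at this
    exact this rfl
  refine (mem_LE_pre G _ n γ _).2 ⟨k, hkn, rfl, ?_, fun j hj _ => hk j hj⟩
  intro h
  exact h1.1.hzS (h ▸ h4)

def Good : Set (ℕ → E) :=
  {γ | (∀ i : ℕ, G.dst (γ i) = G.src (γ (i + 1))) ∧ G.src (γ 0) = o ∧ Function.Bijective γ}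

def GN (D0 : Finset V) (n : ℕ) : Set (ℕ → E) :=
  {γ | ∃ m ≤ n, (∀ d ∈ D0, ∀ i ≥ m, G.src (γ i) ≠ d) ∧
    ∀ j < m, ∀ i ≥ n, G.src (γ i) ≠ G.src (γ j)}

lemma good_sub (hvis : ∀ γ ∈ Good G o, ∀ v, ∃ i, G.src (γ i) = v) (D0 : Finset V) (n : ℕ) :
    Good G o ∩ GN G D0 n ⊆ EE G o D0 n ∅ := by
  rintro γ ⟨hg, m, hmn, hm1, hm2⟩
  have hv := hvis γ hg
  obtain ⟨hp, ho, hb⟩ := hg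
  set S : Finset V := ((Finset.range n).image (fun i => G.src (γ i))).filter
    (fun v => ∀ i, G.src (γ (n + i)) ≠ v) with hS
  have hSiff : ∀ v, v ∈ S ↔ ∀ i, G.src (γ (n + i)) ≠ v := by
    intro v
    rw [hS, Finset.mem_filter]
    refine ⟨fun h => h.2, fun h => ⟨?_, h⟩⟩
    obtain ⟨i, hi⟩ := hv v
    refine Finset.mem_image.2 ⟨i, Finset.mem_range.2 ?_, hi⟩
    by_contra hin
    have := h (i - n)
    rw [Nat.add_sub_cancel' (not_lt.1 hin)] at this
    exact this hi
  have hpath : IsPathList G o (G.src (γ n)) (pre n γ) := ho ▸ pre_path G n γ hp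
  have hnd : (pre n γ).Nodup := by
    rw [pre, List.nodup_ofFn]
    intro a b hab
    exact Fin.ext (hb.1 hab)
  refine Set.mem_iUnion.2 ⟨((pre n γ).toFinset, G.src (γ n), S), ?_, rfl, hSiff⟩
  rw [mem_PL]
  refine ⟨⟨?_, ?_, ?_⟩, path_bal G _ _ _ hpath hnd, LE_arb G o _ _ hpath, ?_, by simp, ?_, hpath⟩
  · intro h
    exact (hSiff _).1 h 0 rfl
  · intro e he
    obtain ⟨k, rfl⟩ := hb.2 e
    rw [List.mem_toFinset, mem_pre]
    refine ⟨k, ?_, rfl⟩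
    by_contra hin
    have := (hSiff _).1 he (k - n)
    rw [Nat.add_sub_cancel' (not_lt.1 hin)] at this
    exact this rfl
  · intro v _
    obtain ⟨i, hi⟩ := hv v
    exact ⟨_, hi⟩
  · have key : ∀ d ∈ D0, ∀ u, Relation.ReflTransGen
        (G.step (LE G (G.src (γ n)) (pre n γ) : Set E)) u d → ∀ i ≥ m, G.src (γ i) ≠ u := by
      intro d hd u hu
      induction hu using Relation.ReflTransGen.head_induction_on with
      | refl => exact hm1 d hd
      | head h _ ih =>
        obtain ⟨e, he, rfl, rfl⟩ := h
        obtain ⟨k, hk, rfl, _, h3⟩ := (mem_LE_pre G _ n γ e).1 he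
        have hkm : k + 1 < m := by
          by_contra hkm
          exact ih (k + 1) (not_lt.1 hkm) (hp k).symm
        intro i hi
        by_cases hin : i < n
        · exact h3 i (by omega) hin
        · exact hm2 k (by omega) i (not_lt.1 hin)
    intro d hd
    refine Finset.mem_filter.2 ⟨?_, fun u hu => ?_⟩
    · exact (hSiff d).2 fun i => hm1 d hd _ (by omega)
    · exact (hSiff u).2 fun i => key d hd u hu _ (by omega)
  · rw [List.toFinset_val, List.dedup_eq_self.2 hnd]

lemma GN_mono (D0 : Finset V) : Monotone (GN G D0) := by
  intro n n' h γ
  rintro ⟨m, h1, h2, h3⟩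
  exact ⟨m, h1.trans h, h2, fun j hj i hi => h3 j hj i (h.trans hi)⟩

lemma GN_good (hlf : ∀ v, (G.outEdges v).Finite) (D0 : Finset V) (γ : ℕ → E)
    (hγ : γ ∈ Good G o) : ∃ n, γ ∈ GN G D0 n := by
  have hfin : ∀ v, ∃ m, ∀ i ≥ m, G.src (γ i) ≠ v := by
    intro v
    have : {i | G.src (γ i) = v}.Finite := (hlf v).preimage hγ.2.2.1.injOn
    obtain ⟨m, hm⟩ := this.bddAbove
    exact ⟨m + 1, fun i hi h => by have := hm h; omega⟩
  choose f hf using hfin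
  have hfin2 : ∀ K : Finset V, ∃ m, ∀ v ∈ K, ∀ i ≥ m, G.src (γ i) ≠ v := by
    intro K
    exact ⟨K.sup f, fun v hv i hi => hf v i ((Finset.le_sup hv).trans hi)⟩
  obtain ⟨m, hm⟩ := hfin2 D0
  obtain ⟨n, hn⟩ := hfin2 ((Finset.range m).image fun j => G.src (γ j))
  refine ⟨max m n, m, le_max_left _ _, hm, fun j hj i hi => ?_⟩
  exact hn _ (Finset.mem_image.2 ⟨j, Finset.mem_range.2 hj, rfl⟩) i ((le_max_right _ _).trans hi)

lemma EE_tendsto (hμ : ProperGibbs G o μ) (hvis : ∀ γ ∈ Good G o, ∀ v, ∃ i, G.src (γ i) = v)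
    (hlf : ∀ v, (G.outEdges v).Finite) (D0 : Finset V) :
    Tendsto (fun n => μ (EE G o D0 n ∅)) atTop (nhds 1) := by
  have hmono : Monotone (fun n => Good G o ∩ GN G D0 n) := by
    intro n n' h
    exact Set.inter_subset_inter_right _ (GN_mono G D0 h)
  have h1 := tendsto_measure_iUnion_atTop (μ := μ) hmono
  have h2 : (⋃ n, Good G o ∩ GN G D0 n) = Good G o := by
    ext γ
    simp only [Set.mem_iUnion, Set.mem_inter_iff, exists_and_left, and_iff_left_iff_imp]
    exact fun h => GN_good G o hlf D0 γ h
  rw [h2] at h1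
  have h3 : μ (Good G o) = 1 := hμ.2.1
  rw [h3] at h1
  refine tendsto_of_tendsto_of_tendsto_of_le_of_le h1 tendsto_const_nhds ?_ ?_
  · intro n
    exact measure_mono (good_sub G o hvis D0 n)
  · intro n
    exact (measure_mono (Set.subset_univ _)).trans hμ.1.le

lemma main_eq (hμ : ProperGibbs G o μ) (hvis : ∀ γ ∈ Good G o, ∀ v, ∃ i, G.src (γ i) = v)
    (hlf : ∀ v, (G.outEdges v).Finite) (F : Finset E) (L : ℝ≥0∞) (hL : L ≠ ⊤)
    (hlim : Tendsto (fun U : Finset V => wiredUACyl G (U : Set V) F) atTop (nhds L)) :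
    μ (LX G F) = L := by
  have hbd : ∀ ε : ℝ≥0∞, ε ≠ 0 → L - ε ≤ μ (LX G F) ∧ μ (LX G F) ≤ L + ε := by
    intro ε hε
    have hev := (ENNReal.tendsto_nhds hL).1 hlim ε (pos_iff_ne_zero.2 hε)
    obtain ⟨D1, hD1⟩ := eventually_atTop.1 hev
    set D0 := D1 ∪ F.image G.src with hD0
    have hF : ∀ e ∈ F, G.src e ∈ D0 := fun e he =>
      Finset.mem_union_right _ (Finset.mem_image_of_mem _ he)
    have hD : ∀ D : Finset V, D0 ⊆ D → wiredUACyl G (D : Set V) F ∈ Set.Icc (L - ε) (L + ε) :=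
      fun D h => hD1 D (Finset.union_subset_left h)
    have ht := EE_tendsto G o μ hμ hvis hlf D0
    have hmeas : ∀ n, MeasurableSet (EE G o D0 n ∅) := fun n =>
      MeasurableSet.iUnion fun i => meas_XX G o D0 n ∅ i
    have hfinm : ∀ s, μ s ≠ ⊤ := fun s =>
      ne_top_of_le_ne_top ENNReal.one_ne_top ((measure_mono (Set.subset_univ s)).trans hμ.1.le)
    constructor
    · have h1 : Tendsto (fun n => μ (EE G o D0 n ∅) * (L - ε)) atTop (nhds (1 * (L - ε))) :=
        ENNReal.Tendsto.mul_const ht (Or.inl one_ne_zero)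
      rw [one_mul] at h1
      refine le_of_tendsto' h1 fun n => ?_
      exact (EE_lower G o μ hμ D0 n F hF _ (fun D h => (hD D h).1)).trans
        (measure_mono (EE_sub G o D0 n F hF))
    · have h1 : Tendsto (fun n => μ (EE G o D0 n ∅) * (L + ε) + (1 - μ (EE G o D0 n ∅))) atTop
          (nhds (1 * (L + ε) + (1 - 1))) := by
        refine (ENNReal.Tendsto.mul_const ht (Or.inl one_ne_zero)).add ?_
        exact ENNReal.Tendsto.sub tendsto_const_nhds ht (Or.inl ENNReal.one_ne_top)
      rw [one_mul, tsub_self, add_zero] at h1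
      refine ge_of_tendsto' h1 fun n => ?_
      have h2 : μ (EE G o D0 n ∅)ᶜ = 1 - μ (EE G o D0 n ∅) := by
        rw [measure_compl (hmeas n) (hfinm _), hμ.1]
      rw [← h2]
      have h3 := EE_upper G o μ hμ D0 n F hF _ (fun D h => (hD D h).2)
      calc μ (LX G F) ≤ μ ((LX G F ∩ EE G o D0 n ∅) ∪ (EE G o D0 n ∅)ᶜ) := by
            apply measure_mono
            intro γ hγ
            by_cases h : γ ∈ EE G o D0 n ∅
            · exact Or.inl ⟨hγ, h⟩
            · exact Or.inr h
        _ ≤ μ (LX G F ∩ EE G o D0 n ∅) + μ (EE G o D0 n ∅)ᶜ := measure_union_le _ _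
        _ ≤ _ := by
            gcongr
            exact (measure_mono (EE_sup G o D0 n F hF)).trans h3
  apply le_antisymm
  · refine ENNReal.le_of_forall_pos_le_add fun ε hε _ => ?_
    exact (hbd ε (by exact_mod_cast hε.ne')).2
  · refine ENNReal.le_of_forall_pos_le_add fun ε hε _ => ?_
    exact tsub_le_iff_right.1 (hbd ε (by exact_mod_cast hε.ne')).1

end MEAS

/-- If `μ` is a proper Gibbs measure on Eulerian paths from `o` to `∞` on a
sourced Eulerian digraph, then the last-exit arboretum of the random path is distributed as the
wired uniform spanning in-arboretum: the probability that it contains any fixed finite edge set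
is the limit of the corresponding wired uniform spanning in-arborescence probabilities along any
exhaustion. -/
theorem stmt16 {V E : Type} [Countable V] [Countable E] [MeasurableSpace E]
    [DiscreteMeasurableSpace E]
    (G : DigraphStruct V E) (o : V) (hG : G.IsSourcedEulerian o)
    (μ : Measure (ℕ → E)) (hμ : ProperGibbs G o μ)
    (Vn : ℕ → Set V) (hVn : IsExhaustion Vn) (F : Finset E) :
    Filter.Tendsto (fun n => wiredUACyl G (Vn n) F) Filter.atTop
      (nhds (μ {γ | ∀ e ∈ F, e ∈ G.lastExitSet γ})) := by
  classical
  have hvis : ∀ γ ∈ Good G o, ∀ v, ∃ i, G.src (γ i) = v := by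
    rintro γ ⟨hp, _, hb⟩ v
    haveI := hG.infinite
    obtain ⟨u, hu⟩ := exists_ne v
    rcases (hG.conn v u).cases_head with h | ⟨c, ⟨e, he⟩, _⟩
    · exact absurd h.symm hu
    · obtain ⟨i, rfl⟩ := hb.2 e
      rcases he with ⟨h, _⟩ | ⟨_, h⟩
      · exact ⟨i, h⟩
      · exact ⟨i + 1, (hp i).symm.trans h⟩
  have hlf : ∀ v, (G.outEdges v).Finite := fun v => (hG.locFin v).1
  obtain ⟨γ, hγ⟩ : (Good G o).Nonempty := by
    by_contra h
    rw [Set.not_nonempty_iff_eq_empty] at h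
    have h1 : μ (Good G o) = 1 := hμ.2.1
    rw [h] at h1
    simp at h1
  have hcO : ∀ v, G.outDeg v = (hlf v).toFinset.card := fun v =>
    Set.ncard_eq_toFinset_card _ (hlf v)
  have hcI : ∀ v, G.inDeg v = (hG.locFin v).2.toFinset.card := fun v =>
    Set.ncard_eq_toFinset_card _ (hG.locFin v).2
  obtain ⟨L, hL, hlim⟩ := wired_limit G (fun v => (hlf v).toFinset)
    (fun v e => by rw [Set.Finite.mem_toFinset]; rfl)
    (fun v => (hG.locFin v).2.toFinset)
    (fun v e => by rw [Set.Finite.mem_toFinset]; rfl) o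
    (fun v hv => by rw [← hcO, ← hcI]; exact hG.balanced v hv)
    (by rw [← hcO, ← hcI]; exact hG.source)
    (by
      intro M ⟨v, hv⟩
      by_contra hcon
      push Not at hcon
      obtain ⟨i, hi⟩ := hvis γ hγ v
      have hin : ∀ k, G.src (γ (i + k)) ∈ M := by
        intro k
        induction k with
        | zero => rw [add_zero, hi]; exact hv
        | succ k ih =>
          have := hcon _ ih (γ (i + k)) (by rw [Set.Finite.mem_toFinset]; rfl)
          rw [hγ.1 (i + k)] at this
          exact this
      have hfin : (⋃ v ∈ M, G.outEdges v).Finite := M.finite_toSet.biUnion fun v _ => hlf v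
      have hinf : (Set.range fun k => γ (i + k)).Infinite := by
        apply Set.infinite_range_of_injective
        intro a b hab
        have := hγ.2.2.1 hab
        omega
      refine hinf (hfin.subset ?_)
      rintro _ ⟨k, rfl⟩
      exact Set.mem_biUnion (hin k) rfl)
    γ hγ.1 hγ.2.1 (hvis γ hγ) F
  have hmain : μ {γ | ∀ e ∈ F, e ∈ G.lastExitSet γ} = L :=
    main_eq G o μ hμ hvis hlf F L hL hlim
  rw [hmain]
  have ht : Tendsto (fun n => (hVn.1 n).toFinset) atTop atTop := by
    have hmono : Monotone Vn := monotone_nat_of_le_succ hVn.2.1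
    refine Filter.tendsto_atTop_finset_of_monotone ?_ ?_
    · intro a b hab
      exact Set.Finite.toFinset_subset_toFinset.2 (hmono hab)
    · intro v
      have : v ∈ ⋃ n, Vn n := by rw [hVn.2.2]; trivial
      obtain ⟨n, hn⟩ := Set.mem_iUnion.1 this
      exact ⟨n, (Set.Finite.mem_toFinset _).2 hn⟩
  have := hlim.comp ht
  refine this.congr fun n => ?_
  simp only [Function.comp, Set.Finite.coe_toFinset]

end DF
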